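/- Let K be a miserly domain centered at the origin. Then no segment of the boundary of K is parametrized by a multi-curve of rank two: there is no multi-curve σ on [t₀,t₁] (t₀ < t₁) such that each σ_j is a C² regular injective curve mapping into the boundary of K, exactly one index j₀ ∈ {0,2,4} has the image of σ_{j₀} contained in an affine line, and for the other two indices j ∈ {0,2,4} \ {j₀} the curvature is nonzero, i.e., σ_j′(t) ∧ σ_j″(t) ≠ 0 for all t ∈ (t₀,t₁). -/

import Mathlib

open MeasureTheory

noncomputable section

/-- The wedge (cross) product of two planar vectors. -/
def wedge (v w : ℝ × ℝ) : ℝ := v.1 * w.2 - v.2 * w.1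

/-- A centrally symmetric convex domain in the plane. -/
def IsCSCD (K : Set (ℝ × ℝ)) : Prop :=
  Convex ℝ K ∧ IsCompact K ∧ (interior K).Nonempty ∧ K = -K

/-- The lattice spanned over `ℤ` by the vectors `v` and `w`. -/
def latticeOf (v w : ℝ × ℝ) : Set (ℝ × ℝ) :=
  {p | ∃ m n : ℤ, p = (m : ℝ) • v + (n : ℝ) • w}

/-- `Λ + K` is a packing of `K`. -/
def IsPacking (K Λ : Set (ℝ × ℝ)) : Prop :=
  ∀ p ∈ Λ, ∀ q ∈ Λ, p ≠ q →
    interior ((fun x => p + x) '' K) ∩ interior ((fun x => q + x) '' K) = ∅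

/-- The set of densities of lattice packings of `K`. -/
def packingDensities (K : Set (ℝ × ℝ)) : Set ℝ :=
  {d | ∃ v w : ℝ × ℝ, wedge v w ≠ 0 ∧ IsPacking K (latticeOf v w) ∧
       d = (volume K).toReal / |wedge v w|}

/-- `δ_lat(K)`: the supremum of densities of lattice packings of `K`. -/
def deltaLat (K : Set (ℝ × ℝ)) : ℝ := sSup (packingDensities K)

/-- A miserly domain: a centrally symmetric convex domain minimizing `δ_lat`. -/
def IsMiserly (K : Set (ℝ × ℝ)) : Prop :=
  IsCSCD K ∧ ∀ K' : Set (ℝ × ℝ), IsCSCD K' → deltaLat K ≤ deltaLat K'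

/-- A multi-point. -/
def IsMultiPoint (u : ZMod 6 → ℝ × ℝ) : Prop :=
  ∀ j, u j + u (j + 2) + u (j + 4) = 0 ∧ u (j + 3) = -u j ∧
    wedge (u j) (u (j + 2)) = Real.sqrt 3 / 2

/-- A multi-curve on `[t₀, t₁]`. -/
def IsMultiCurve (σ : ZMod 6 → ℝ → ℝ × ℝ) (t₀ t₁ : ℝ) : Prop :=
  (∀ j, ContDiffOn ℝ 1 (σ j) (Set.Icc t₀ t₁)) ∧
  (∀ t ∈ Set.Icc t₀ t₁, IsMultiPoint (fun j => σ j t))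

open Set Filter Topology

/-! ### Centrally symmetric convex domains and their gauges -/

lemma wedge_add_left (u v w : ℝ × ℝ) : wedge (u + v) w = wedge u w + wedge v w := by
  simp only [wedge, Prod.fst_add, Prod.snd_add]; ring

lemma wedge_add_right (u v w : ℝ × ℝ) : wedge u (v + w) = wedge u v + wedge u w := by
  simp only [wedge, Prod.fst_add, Prod.snd_add]; ring

lemma wedge_smul_left (a : ℝ) (u v : ℝ × ℝ) : wedge (a • u) v = a * wedge u v := by
  simp only [wedge, Prod.smul_fst, Prod.smul_snd, smul_eq_mul]; ring

lemma wedge_smul_right (a : ℝ) (u v : ℝ × ℝ) : wedge u (a • v) = a * wedge u v := by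
  simp only [wedge, Prod.smul_fst, Prod.smul_snd, smul_eq_mul]; ring

lemma wedge_self (u : ℝ × ℝ) : wedge u u = 0 := by
  simp only [wedge]; ring

lemma wedge_swap (u v : ℝ × ℝ) : wedge u v = -wedge v u := by
  simp only [wedge]; ring

lemma wedge_neg_right (u v : ℝ × ℝ) : wedge u (-v) = -wedge u v := by
  simp only [wedge, Prod.fst_neg, Prod.snd_neg]; ring

lemma wedge_neg_left (u v : ℝ × ℝ) : wedge (-u) v = -wedge u v := by
  simp only [wedge, Prod.fst_neg, Prod.snd_neg]; ring

lemma continuous_wedge {X : Type*} [TopologicalSpace X] {f g : X → ℝ × ℝ}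
    (hf : Continuous f) (hg : Continuous g) : Continuous fun x => wedge (f x) (g x) := by
  unfold wedge; fun_prop

/-- Cramer's rule in the plane. -/
lemma wedge_smul_eq (p s x : ℝ × ℝ) :
    wedge p s • x = wedge x s • p + wedge p x • s := by
  ext <;> simp only [wedge, Prod.smul_fst, Prod.smul_snd, Prod.fst_add, Prod.snd_add,
    smul_eq_mul] <;> ring

namespace IsCSCD

variable {K : Set (ℝ × ℝ)}

lemma neg_mem (hK : IsCSCD K) {x : ℝ × ℝ} (hx : x ∈ K) : -x ∈ K := by
  have h := hK.2.2.2
  rw [h] at hx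
  simpa using hx

lemma neg_mem_iff (hK : IsCSCD K) {x : ℝ × ℝ} : -x ∈ K ↔ x ∈ K :=
  ⟨fun h => by simpa using hK.neg_mem h, hK.neg_mem⟩

lemma neg_interior (hK : IsCSCD K) {x : ℝ × ℝ} (hx : x ∈ interior K) : -x ∈ interior K := by
  have h : interior K = -interior K := by
    conv_lhs => rw [hK.2.2.2]
    exact (Homeomorph.neg (ℝ × ℝ)).preimage_interior K |>.symm
  rw [h] at hx
  simpa using hx

lemma isClosed (hK : IsCSCD K) : IsClosed K := hK.2.1.isClosed

lemma zero_mem_interior (hK : IsCSCD K) : (0 : ℝ × ℝ) ∈ interior K := by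
  obtain ⟨x, hx⟩ := hK.2.2.1
  have h := hK.1.interior hx (hK.neg_interior hx) (a := 1 / 2) (b := 1 / 2)
    (by norm_num) (by norm_num) (by norm_num)
  simpa using h

lemma nhds_zero (hK : IsCSCD K) : K ∈ 𝓝 (0 : ℝ × ℝ) :=
  mem_interior_iff_mem_nhds.1 hK.zero_mem_interior

lemma mem_iff (hK : IsCSCD K) {x : ℝ × ℝ} : x ∈ K ↔ gauge K x ≤ 1 := by
  rw [gauge_le_one_iff_mem_closure hK.1 hK.nhds_zero, hK.isClosed.closure_eq]

lemma mem_interior_iff (hK : IsCSCD K) {x : ℝ × ℝ} : x ∈ interior K ↔ gauge K x < 1 :=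
  (gauge_lt_one_iff_mem_interior hK.1 hK.nhds_zero).symm

lemma mem_frontier_iff (hK : IsCSCD K) {x : ℝ × ℝ} : x ∈ frontier K ↔ gauge K x = 1 :=
  (gauge_eq_one_iff_mem_frontier hK.1 hK.nhds_zero).symm

lemma frontier_iff (hK : IsCSCD K) {x : ℝ × ℝ} : x ∈ frontier K ↔ x ∈ K ∧ x ∉ interior K := by
  rw [hK.isClosed.frontier_eq]; rfl

lemma gauge_neg' (hK : IsCSCD K) (x : ℝ × ℝ) : gauge K (-x) = gauge K x :=
  gauge_neg (fun _ h => hK.neg_mem h) x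

lemma gauge_real_smul (hK : IsCSCD K) (r : ℝ) (x : ℝ × ℝ) :
    gauge K (r • x) = |r| * gauge K x := by
  rcases le_total 0 r with h | h
  · rw [gauge_smul_of_nonneg h, abs_of_nonneg h, smul_eq_mul]
  · rw [← hK.gauge_neg', ← neg_smul, gauge_smul_of_nonneg (neg_nonneg.2 h), abs_of_nonpos h,
      smul_eq_mul]

lemma gauge_add (hK : IsCSCD K) (x y : ℝ × ℝ) : gauge K (x + y) ≤ gauge K x + gauge K y :=
  gauge_add_le hK.1 (absorbent_nhds_zero hK.nhds_zero) x y

lemma gauge_pos' (hK : IsCSCD K) {x : ℝ × ℝ} (hx : x ≠ 0) : 0 < gauge K x :=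
  (gauge_pos (absorbent_nhds_zero hK.nhds_zero)
    ((NormedSpace.isVonNBounded_iff ℝ).2 hK.2.1.isBounded)).2 hx

lemma neg_frontier (hK : IsCSCD K) {x : ℝ × ℝ} (hx : x ∈ frontier K) : -x ∈ frontier K := by
  rw [hK.mem_frontier_iff] at hx ⊢
  rw [hK.gauge_neg', hx]

lemma combo_mem (hK : IsCSCD K) {x y : ℝ × ℝ} (hx : x ∈ K) (hy : y ∈ K) {a b : ℝ}
    (hab : |a| + |b| ≤ 1) : a • x + b • y ∈ K := by
  rw [hK.mem_iff] at *
  have h := hK.gauge_add (a • x) (b • y)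
  rw [hK.gauge_real_smul, hK.gauge_real_smul] at h
  nlinarith [abs_nonneg a, abs_nonneg b]

end IsCSCD

/-- A supporting line through a point that is not interior to a planar convex body. -/
lemma exists_support {K : Set (ℝ × ℝ)} (hc : Convex ℝ K) (hi : (interior K).Nonempty)
    {x : ℝ × ℝ} (hx : x ∉ interior K) :
    ∃ α β : ℝ, (∀ a ∈ interior K, α * a.1 + β * a.2 < α * x.1 + β * x.2) ∧
      ∀ a ∈ K, α * a.1 + β * a.2 ≤ α * x.1 + β * x.2 := by
  obtain ⟨f, hf⟩ := geometric_hahn_banach_open_point hc.interior isOpen_interior hx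
  have key : ∀ a : ℝ × ℝ, f (1, 0) * a.1 + f (0, 1) * a.2 = f a := by
    intro a
    have : a = a.1 • ((1, 0) : ℝ × ℝ) + a.2 • ((0, 1) : ℝ × ℝ) := by ext <;> simp
    conv_rhs => rw [this]
    rw [map_add, map_smul, map_smul, smul_eq_mul, smul_eq_mul]
    ring
  refine ⟨f (1, 0), f (0, 1), fun a ha => ?_, fun a ha => ?_⟩
  · rw [key, key]; exact hf a ha
  · rw [key, key]
    have hcl : a ∈ closure (interior K) := by
      rw [hc.closure_interior_eq_closure_of_nonempty_interior hi]
      exact subset_closure ha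
    have hclosed : IsClosed {b | f b ≤ f x} := isClosed_le f.continuous continuous_const
    exact closure_minimal (fun b hb => (hf b hb).le) hclosed hcl

/-! ### Admissible lattices -/

/-- The lattice spanned by `v` and `w` has no nonzero point in the interior of `K`. -/
def Admissible (K : Set (ℝ × ℝ)) (v w : ℝ × ℝ) : Prop :=
  ∀ m n : ℤ, (m ≠ 0 ∨ n ≠ 0) → (m : ℝ) • v + (n : ℝ) • w ∉ interior K

lemma lattice_point_ne_zero {v w : ℝ × ℝ} (hvw : wedge v w ≠ 0) {m n : ℤ}
    (hmn : m ≠ 0 ∨ n ≠ 0) : (m : ℝ) • v + (n : ℝ) • w ≠ 0 := by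
  intro h
  have h1 : wedge ((m : ℝ) • v + (n : ℝ) • w) w = m * wedge v w := by
    rw [wedge_add_left, wedge_smul_left, wedge_smul_left, wedge_self]; ring
  have h2 : wedge v ((m : ℝ) • v + (n : ℝ) • w) = n * wedge v w := by
    rw [wedge_add_right, wedge_smul_right, wedge_smul_right, wedge_self]; ring
  rw [h] at h1 h2
  have h3 : (m : ℝ) = 0 := by
    have hz : wedge 0 w = 0 := by simp [wedge]
    rw [hz] at h1
    exact (mul_eq_zero.1 h1.symm).resolve_right hvw
  have h4 : (n : ℝ) = 0 := by
    have hz : wedge v 0 = 0 := by simp [wedge]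
    rw [hz] at h2
    exact (mul_eq_zero.1 h2.symm).resolve_right hvw
  rcases hmn with h | h
  · exact h (by exact_mod_cast h3)
  · exact h (by exact_mod_cast h4)

lemma interior_translate (K : Set (ℝ × ℝ)) (p : ℝ × ℝ) :
    interior ((fun x => p + x) '' K) = (fun x => p + x) '' interior K :=
  ((Homeomorph.addLeft p).image_interior K).symm

lemma isPacking_iff_admissible {K : Set (ℝ × ℝ)} (hK : IsCSCD K) {v w : ℝ × ℝ}
    (hvw : wedge v w ≠ 0) :
    IsPacking K (latticeOf v w) ↔ Admissible K ((1 / 2 : ℝ) • v) ((1 / 2 : ℝ) • w) := by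
  constructor
  · intro h m n hmn hx
    have hp := h ((m : ℝ) • v + (n : ℝ) • w) ⟨m, n, rfl⟩ 0 ⟨0, 0, by simp⟩
      (lattice_point_ne_zero hvw hmn)
    rw [interior_translate, interior_translate] at hp
    refine Set.eq_empty_iff_forall_notMem.1 hp
      ((m : ℝ) • ((1 / 2 : ℝ) • v) + (n : ℝ) • ((1 / 2 : ℝ) • w)) ⟨⟨_, hK.neg_interior hx, ?_⟩,
        ⟨_, hx, ?_⟩⟩
    · simp only
      module
    · simp
  · rintro h _ ⟨m, n, rfl⟩ _ ⟨m', n', rfl⟩ hne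
    rw [interior_translate, interior_translate, Set.eq_empty_iff_forall_notMem]
    rintro _ ⟨⟨x, hx, rfl⟩, ⟨y, hy, hxy⟩⟩
    have hmn : m' - m ≠ 0 ∨ n' - n ≠ 0 := by
      by_contra! hc
      apply hne
      rw [show m' = m by lia, show n' = n by lia]
    refine h (m' - m) (n' - n) hmn ?_
    have hmid := hK.1.interior hx (hK.neg_interior hy) (a := 1 / 2) (b := 1 / 2)
      (by norm_num) (by norm_num) (by norm_num)
    convert hmid using 1
    have hx' : x = (m' : ℝ) • v + (n' : ℝ) • w + y - ((m : ℝ) • v + (n : ℝ) • w) := by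
      simp only at hxy
      rw [hxy]; abel
    rw [hx']
    push_cast
    module

/-- The open hexagon with vertices `±p`, `±s`, `±(s + p)` lies in the interior. -/
lemma hexagon_interior {K : Set (ℝ × ℝ)} (hK : IsCSCD K) {p s : ℝ × ℝ} (hp : p ∈ K)
    (hs : s ∈ K) (hsp : s + p ∈ K) (hD : 0 < wedge p s) {β θ : ℝ} (h0 : 0 < β) (h1 : β < 1)
    (hθ : β - 1 < θ) (hθ' : θ < 1) : β • s + θ • p ∈ interior K := by
  rw [mem_interior]
  refine ⟨{x | 0 < wedge p x ∧ wedge p x < wedge p s ∧ wedge p x - wedge p s < wedge x s ∧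
    wedge x s < wedge p s}, ?_, ?_, ?_⟩
  · rintro x ⟨hx0, hx1, hx2, hx3⟩
    have hcr := wedge_smul_eq p s x
    set D := wedge p s with hDdef
    set b := wedge p x / D with hb
    set t := wedge x s / D with ht
    have hb0 : 0 < b := div_pos hx0 hD
    have hb1 : b < 1 := (div_lt_one hD).2 hx1
    have ht0 : b - 1 < t := by
      rw [hb, ht, lt_div_iff₀ hD, sub_mul, div_mul_cancel₀ _ hD.ne', one_mul]; exact hx2
    have ht1 : t < 1 := (div_lt_one hD).2 hx3
    have hx : x = b • s + t • p := by
      have : x = D⁻¹ • (D • x) := by rw [smul_smul, inv_mul_cancel₀ hD.ne', one_smul]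
      rw [this, hcr, smul_add, smul_smul, smul_smul, add_comm, hb, ht, div_eq_inv_mul,
        div_eq_inv_mul]
    -- the point lies on the horizontal chord between the two slanted sides
    set l : ℝ := (1 - t) / (2 - b) with hl
    have h2b : 0 < 2 - b := by linarith
    have hl0 : 0 ≤ l := div_nonneg (by linarith) h2b.le
    have hl1 : l ≤ 1 := (div_le_one h2b).2 (by linarith)
    have hleft : b • s + (1 - b) • (-p) ∈ K :=
      hK.1 hs (hK.neg_mem hp) hb0.le (by linarith) (by ring)
    have hright : b • (s + p) + (1 - b) • p ∈ K :=
      hK.1 hsp hp hb0.le (by linarith) (by ring)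
    have := hK.1 hleft hright hl0 (by linarith : 0 ≤ 1 - l) (by ring)
    convert this using 1
    have hlt : t = 1 - l * (2 - b) := by
      rw [hl, div_mul_cancel₀ _ h2b.ne']; ring
    rw [hx, hlt]
    module
  · refine IsOpen.inter ?_ (IsOpen.inter ?_ (IsOpen.inter ?_ ?_))
    · exact isOpen_lt continuous_const (continuous_wedge continuous_const continuous_id)
    · exact isOpen_lt (continuous_wedge continuous_const continuous_id) continuous_const
    · exact isOpen_lt ((continuous_wedge continuous_const continuous_id).sub continuous_const)
        (continuous_wedge continuous_id continuous_const)
    · exact isOpen_lt (continuous_wedge continuous_id continuous_const) continuous_const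
  · have e1 : wedge p (β • s + θ • p) = β * wedge p s := by
      rw [wedge_add_right, wedge_smul_right, wedge_smul_right, wedge_self]; ring
    have e2 : wedge (β • s + θ • p) s = θ * wedge p s := by
      rw [wedge_add_left, wedge_smul_left, wedge_smul_left, wedge_self]; ring
    simp only [Set.mem_ofPred_eq, e1, e2]
    refine ⟨by positivity, by nlinarith, by nlinarith, by nlinarith⟩

/-- A lattice line meets the interior if it is closer to `ℝ p` than the side of an inscribed
hexagon through `p`. -/
lemma exists_translate_mem_interior {K : Set (ℝ × ℝ)} (hK : IsCSCD K) {p s q : ℝ × ℝ}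
    (hp : p ∈ K) (hs : s ∈ K) (hsp : s + p ∈ K) (hq : 0 < wedge p q)
    (hqs : wedge p q < wedge p s) : ∃ k : ℤ, q + (k : ℝ) • p ∈ interior K := by
  have hD : 0 < wedge p s := hq.trans hqs
  set b := wedge p q / wedge p s with hb
  set t := wedge q s / wedge p s with ht
  have hb0 : 0 < b := div_pos hq hD
  have hb1 : b < 1 := (div_lt_one hD).2 hqs
  have hx : q = b • s + t • p := by
    have hcr := wedge_smul_eq p s q
    have : q = (wedge p s)⁻¹ • (wedge p s • q) := by
      rw [smul_smul, inv_mul_cancel₀ hD.ne', one_smul]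
    rw [this, hcr, smul_add, smul_smul, smul_smul, add_comm, hb, ht, div_eq_inv_mul,
      div_eq_inv_mul]
  refine ⟨-⌊t⌋, ?_⟩
  have hf0 := Int.fract_nonneg t
  have hf1 := Int.fract_lt_one t
  have := hexagon_interior hK hp hs hsp hD hb0 hb1 (θ := Int.fract t) (by linarith) hf1
  convert this using 1
  rw [hx, Int.fract]
  push_cast
  module

/-- Among the inscribed hexagons with a given boundary vertex, the area is maximal. -/
lemma wedge_le_of_hexagon {K : Set (ℝ × ℝ)} (hK : IsCSCD K) {p s s' : ℝ × ℝ}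
    (hp : p ∈ K) (hs : s ∈ K) (hsp : s + p ∈ K) (hs' : s' ∈ frontier K)
    (hsp' : s' + p ∈ frontier K) (h0 : 0 < wedge p s') : wedge p s ≤ wedge p s' := by
  by_contra! hlt
  obtain ⟨k, hk⟩ := exists_translate_mem_interior hK hp hs hsp h0 hlt
  rw [hK.frontier_iff] at hs' hsp'
  rcases le_or_gt k 1 with h | h
  · rcases lt_or_eq_of_le h with h | h
    · rcases lt_or_eq_of_le (Int.lt_add_one_iff.1 (show k < 0 + 1 by lia)) with h | h
      · apply hs'.2
        have hk' : (k : ℝ) ≤ -1 := by exact_mod_cast (by lia : k ≤ -1)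
        have hd : 0 < 1 - (k : ℝ) := by linarith
        refine hK.1.openSegment_interior_self_subset_interior hk hsp'.1
          ⟨1 / (1 - k), -k / (1 - k), by positivity, div_pos (by linarith) hd, by
            field_simp; ring, ?_⟩
        have e : s' = ((1 - (k : ℝ)) / (1 - k)) • s' := by rw [div_self hd.ne', one_smul]
        conv_rhs => rw [e]
        match_scalars <;> field_simp <;> ring
      · subst h; simp at hk; exact hs'.2 hk
    · subst h; simp at hk; exact hsp'.2 hk
  · apply hsp'.2
    have hk' : (2 : ℝ) ≤ k := by exact_mod_cast (by lia : 2 ≤ k)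
    have hd : 0 < (k : ℝ) := by linarith
    refine hK.1.openSegment_interior_self_subset_interior hk hs'.1
      ⟨1 / k, (k - 1) / k, by positivity, div_pos (by linarith) hd, by
        field_simp; ring, ?_⟩
    match_scalars <;> field_simp
    ring

/-- A vertex `p` blocks the sextant between `p` and `q` if `q - p ∈ K`. -/
lemma sextant_notMem {K : Set (ℝ × ℝ)} (hK : IsCSCD K) {p q : ℝ × ℝ} (hp : p ∈ K)
    (hpi : p ∉ interior K) (hqp : q - p ∈ K) {m n : ℤ} (hm : 1 ≤ m) (hn : 0 ≤ n) :
    (m : ℝ) • p + (n : ℝ) • q ∉ interior K := by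
  intro hx
  apply hpi
  have hm' : (1 : ℝ) ≤ m := by exact_mod_cast hm
  have hn' : (0 : ℝ) ≤ n := by exact_mod_cast hn
  set l : ℝ := 1 / (1 + m + n) with hl
  have hd : (0 : ℝ) < 1 + m + n := by linarith
  have hl0 : 0 < l := by positivity
  have hlm : l * (1 + m + n) = 1 := by rw [hl, one_div_mul_cancel hd.ne']
  have hl1 : l < 1 := by nlinarith
  have h1 : 0 < 1 - l := by linarith
  have h2 : 0 ≤ l := hl0.le
  have hk : (l / (1 - l)) • p + (l * n / (1 - l)) • (-(q - p)) ∈ K := by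
    refine hK.combo_mem hp (hK.neg_mem hqp) ?_
    rw [abs_of_nonneg (by positivity), abs_of_nonneg (by positivity), ← add_div,
      div_le_one h1]
    nlinarith
  refine hK.1.openSegment_interior_self_subset_interior hx hk ⟨l, 1 - l, hl0, h1, by ring, ?_⟩
  rw [smul_add (1 - l), smul_smul, smul_smul, mul_div_cancel₀ _ h1.ne', mul_div_cancel₀ _ h1.ne']
  have : l * (m + n + 1) = 1 := by linarith
  match_scalars
  · linarith
  · ring

/-- The lattice of an inscribed hexagon is admissible. -/
lemma admissible_of_hexagon {K : Set (ℝ × ℝ)} (hK : IsCSCD K) {p s : ℝ × ℝ}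
    (hp : p ∈ frontier K) (hs : s ∈ frontier K) (hsp : s + p ∈ frontier K) :
    Admissible K p s := by
  have hp' := hK.frontier_iff.1 hp
  have hs' := hK.frontier_iff.1 hs
  have hq' := hK.frontier_iff.1 hsp
  have hnp := hK.frontier_iff.1 (hK.neg_frontier hp)
  have main : ∀ m n : ℤ, (m ≠ 0 ∨ n ≠ 0) → 0 ≤ n →
      (m : ℝ) • p + (n : ℝ) • s ∉ interior K := by
    intro m n hmn hn
    rcases le_or_gt 0 m with hm | hm
    · rcases lt_or_ge n m with h | h
      · have := sextant_notMem hK hp'.1 hp'.2 (q := s + p) (by simpa using hs'.1)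
          (m := m - n) (n := n) (by lia) hn
        convert this using 2
        push_cast; module
      · rcases eq_or_lt_of_le hm with h0 | h0
        · have := sextant_notMem hK hs'.1 hs'.2 (q := s + p) (by simpa using hp'.1)
            (m := n) (n := 0) (by lia) le_rfl
          convert this using 2
          rw [← h0]; simp
        · have := sextant_notMem hK hq'.1 hq'.2 (q := s) (by simpa using hnp.1)
            (m := m) (n := n - m) (by lia) (by lia)
          convert this using 2
          push_cast; module
    · have := sextant_notMem hK hnp.1 hnp.2 (q := s) (by simpa using hq'.1)
            (m := -m) (n := n) (by lia) hn
      convert this using 2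
      push_cast; module
  intro m n hmn hx
  rcases le_total 0 n with hn | hn
  · exact main m n hmn hn hx
  · refine main (-m) (-n) (by lia) (by lia) ?_
    convert hK.neg_interior hx using 1
    push_cast; module

/-- Every boundary point is a vertex of an inscribed affinely regular hexagon. -/
lemma exists_hexagon {K : Set (ℝ × ℝ)} (hK : IsCSCD K) {p : ℝ × ℝ} (hp : p ∈ frontier K) :
    ∃ s, s ∈ frontier K ∧ s + p ∈ frontier K ∧ 0 < wedge p s := by
  rw [hK.mem_frontier_iff] at hp
  have hp0 : p ≠ 0 := by
    rintro rfl
    simp at hp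
  set e : ℝ × ℝ := (-p.2, p.1) with he
  have hpe : 0 < wedge p e := by
    have : wedge p e = p.1 ^ 2 + p.2 ^ 2 := by simp only [wedge, he]; ring
    rw [this]
    by_contra! h
    apply hp0
    ext
    · have : p.1 ^ 2 = 0 := by nlinarith [sq_nonneg p.1, sq_nonneg p.2]
      simpa using this
    · have : p.2 ^ 2 = 0 := by nlinarith [sq_nonneg p.1, sq_nonneg p.2]
      simpa using this
  let c : ℝ → ℝ × ℝ := fun t => (2 * t - 1) • p + (t * (1 - t)) • e
  have hwc : ∀ t, wedge p (c t) = t * (1 - t) * wedge p e := by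
    intro t
    simp only [c]
    rw [wedge_add_right, wedge_smul_right, wedge_smul_right, wedge_self]; ring
  have hc0 : ∀ t, c t ≠ 0 := by
    intro t h
    have h1 := hwc t
    rw [h] at h1
    have h2 : t * (1 - t) = 0 := by
      have : (0 : ℝ) = t * (1 - t) * wedge p e := by simpa [wedge] using h1
      rcases mul_eq_zero.1 this.symm with h | h
      · exact h
      · exact absurd h hpe.ne'
    have h3 : (2 * t - 1) • p = 0 := by simpa [c, h2] using h
    rcases smul_eq_zero.1 h3 with h | h
    · nlinarith
    · exact hp0 h
  have hgc : Continuous (gauge K) := continuous_gauge hK.1 hK.nhds_zero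
  have hcc : Continuous c := by fun_prop
  let u : ℝ → ℝ × ℝ := fun t => (gauge K (c t))⁻¹ • c t
  have huc : Continuous u :=
    ((hgc.comp hcc).inv₀ fun t => (hK.gauge_pos' (hc0 t)).ne').smul hcc
  have hu1 : ∀ t, gauge K (u t) = 1 := by
    intro t
    have := hK.gauge_pos' (hc0 t)
    simp only [u]
    rw [hK.gauge_real_smul, abs_of_pos (inv_pos.2 this), inv_mul_cancel₀ this.ne']
  have hfc : Continuous fun t => gauge K (u t + p) := hgc.comp (huc.add continuous_const)
  have hf0 : gauge K (u 0 + p) = 0 := by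
    have : u 0 = -p := by simp [u, c, hK.gauge_neg', hp]
    rw [this]; simp
  have hf1 : gauge K (u 1 + p) = 2 := by
    have : u 1 = p := by norm_num [u, c, hp]
    rw [this, ← two_smul ℝ p, hK.gauge_real_smul, hp]; norm_num
  obtain ⟨t, ⟨ht0, ht1⟩, ht⟩ := intermediate_value_Icc (zero_le_one' ℝ) hfc.continuousOn
    (show (1 : ℝ) ∈ Icc (gauge K (u 0 + p)) (gauge K (u 1 + p)) by
      rw [hf0, hf1]; constructor <;> norm_num)
  simp only at ht
  have ht0' : t ≠ 0 := by rintro rfl; rw [hf0] at ht; norm_num at ht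
  have ht1' : t ≠ 1 := by rintro rfl; rw [hf1] at ht; norm_num at ht
  refine ⟨u t, hK.mem_frontier_iff.2 (hu1 t), hK.mem_frontier_iff.2 ht, ?_⟩
  simp only [u]
  rw [wedge_smul_right, hwc]
  have h1 : 0 < t := lt_of_le_of_ne ht0 ht0'.symm
  have h2 : 0 < 1 - t := sub_pos.2 (lt_of_le_of_ne ht1 ht1')
  have := hK.gauge_pos' (hc0 t)
  positivity

/-! ### Lattice reduction -/

lemma finite_lattice_points {K : Set (ℝ × ℝ)} (hK : IsCSCD K) {v w : ℝ × ℝ}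
    (hvw : wedge v w ≠ 0) (R : ℝ) (hR : 0 < R) :
    {z : ℤ × ℤ | gauge K ((z.1 : ℝ) • v + (z.2 : ℝ) • w) ≤ R}.Finite := by
  have hb : ∀ u : ℝ × ℝ, ∃ C, ∀ x, gauge K x ≤ R → |wedge x u| ≤ C := by
    intro u
    obtain ⟨C, hC⟩ := hK.2.1.exists_bound_of_continuousOn (f := fun x => wedge x u)
      (continuous_wedge continuous_id continuous_const).continuousOn
    refine ⟨R * C, fun x hx => ?_⟩
    have hx' : R⁻¹ • x ∈ K := by
      rw [hK.mem_iff, hK.gauge_real_smul, abs_of_pos (inv_pos.2 hR), inv_mul_le_iff₀ hR, mul_one]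
      exact hx
    have h := hC _ hx'
    rw [wedge_smul_left, Real.norm_eq_abs, abs_mul, abs_of_pos (inv_pos.2 hR),
      inv_mul_le_iff₀ hR] at h
    exact h
  obtain ⟨C1, hC1⟩ := hb v
  obtain ⟨C2, hC2⟩ := hb w
  set D := |wedge v w| with hD
  have hD0 : 0 < D := abs_pos.2 hvw
  refine ((finite_Icc (-⌈C2 / D⌉) ⌈C2 / D⌉).prod (finite_Icc (-⌈C1 / D⌉) ⌈C1 / D⌉)).subset ?_
  rintro ⟨m, n⟩ hz
  have hz' : gauge K ((m : ℝ) • v + (n : ℝ) • w) ≤ R := hz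
  have key : ∀ (k : ℤ) (C : ℝ), |(k : ℝ)| * D ≤ C → k ∈ Icc (-⌈C / D⌉) ⌈C / D⌉ := by
    intro k C h
    have h1 : |(k : ℝ)| ≤ C / D := (le_div_iff₀ hD0).2 h
    have h2 : |(k : ℝ)| ≤ ⌈C / D⌉ := h1.trans (Int.le_ceil _)
    have h3 : |k| ≤ ⌈C / D⌉ := by exact_mod_cast h2
    exact ⟨(abs_le.1 h3).1, (abs_le.1 h3).2⟩
  refine ⟨key m C2 ?_, key n C1 ?_⟩
  · have := hC2 _ hz'
    rw [wedge_add_left, wedge_smul_left, wedge_smul_left, wedge_self, mul_zero, add_zero,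
      abs_mul] at this
    exact this
  · have := hC1 _ hz'
    rw [wedge_add_left, wedge_smul_left, wedge_smul_left, wedge_self, mul_zero, zero_add,
      abs_mul, wedge_swap w v, abs_neg] at this
    exact this

/-- A lattice has a basis whose first vector is a shortest one. -/
lemma exists_shortest_basis {K : Set (ℝ × ℝ)} (hK : IsCSCD K) {v w : ℝ × ℝ}
    (hvw : wedge v w ≠ 0) : ∃ p q : ℝ × ℝ, 0 < wedge p q ∧ wedge p q = |wedge v w| ∧
      (∃ m n : ℤ, (m ≠ 0 ∨ n ≠ 0) ∧ p = (m : ℝ) • v + (n : ℝ) • w) ∧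
      ∀ k : ℤ, gauge K p ≤ gauge K (q + (k : ℝ) • p) := by
  have hv0 : v ≠ 0 := by
    rintro rfl
    simp [wedge] at hvw
  have hfin : {z : ℤ × ℤ | (z.1 ≠ 0 ∨ z.2 ≠ 0) ∧
      gauge K ((z.1 : ℝ) • v + (z.2 : ℝ) • w) ≤ gauge K v}.Finite :=
    (finite_lattice_points hK hvw (gauge K v) (hK.gauge_pos' hv0)).subset fun z hz => hz.2
  obtain ⟨⟨m, n⟩, ⟨hmn, hle⟩, hmin⟩ := Set.exists_min_image _
    (fun z : ℤ × ℤ => gauge K ((z.1 : ℝ) • v + (z.2 : ℝ) • w)) hfin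
    ⟨(1, 0), Or.inl one_ne_zero, by simp⟩
  simp only at hmn hle hmin
  have hmin' : ∀ m' n' : ℤ, (m' ≠ 0 ∨ n' ≠ 0) → gauge K ((m : ℝ) • v + (n : ℝ) • w) ≤
      gauge K ((m' : ℝ) • v + (n' : ℝ) • w) := by
    intro m' n' h
    by_cases h' : gauge K ((m' : ℝ) • v + (n' : ℝ) • w) ≤ gauge K v
    · exact hmin (m', n') ⟨h, h'⟩
    · exact hle.trans (not_le.1 h').le
  have hp0 : 0 < gauge K ((m : ℝ) • v + (n : ℝ) • w) :=
    hK.gauge_pos' (lattice_point_ne_zero hvw hmn)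
  have hg : Int.gcd m n = 1 := by
    have hgpos : 0 < Int.gcd m n := by
      rw [Nat.pos_iff_ne_zero, ne_eq, Int.gcd_eq_zero_iff]
      lia
    obtain ⟨m', hm'⟩ : (Int.gcd m n : ℤ) ∣ m := Int.gcd_dvd_left ..
    obtain ⟨n', hn'⟩ : (Int.gcd m n : ℤ) ∣ n := Int.gcd_dvd_right ..
    have hmn' : m' ≠ 0 ∨ n' ≠ 0 := by
      by_contra! h
      rw [h.1, mul_zero] at hm'
      rw [h.2, mul_zero] at hn'
      lia
    have h1 := hmin' m' n' hmn'
    have h2 : (m : ℝ) • v + (n : ℝ) • w = (Int.gcd m n : ℝ) • ((m' : ℝ) • v + (n' : ℝ) • w) := by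
      have em : (m : ℝ) = (Int.gcd m n : ℝ) * m' := by exact_mod_cast hm'
      have en : (n : ℝ) = (Int.gcd m n : ℝ) * n' := by exact_mod_cast hn'
      rw [smul_add, smul_smul, smul_smul, ← em, ← en]
    have h3 : gauge K ((m : ℝ) • v + (n : ℝ) • w) =
        Int.gcd m n * gauge K ((m' : ℝ) • v + (n' : ℝ) • w) := by
      conv_lhs => rw [h2]
      rw [hK.gauge_real_smul, abs_of_nonneg (Nat.cast_nonneg _)]
    have h4 : 0 < gauge K ((m' : ℝ) • v + (n' : ℝ) • w) := hp0.trans_le h1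
    have h5 : (Int.gcd m n : ℝ) ≤ 1 := by
      by_contra! h
      nlinarith
    have h6 : Int.gcd m n ≤ 1 := by exact_mod_cast h5
    lia
  obtain ⟨a, b, hab⟩ : ∃ a b : ℤ, m * a + n * b = 1 :=
    ⟨Int.gcdA m n, Int.gcdB m n, by rw [← Int.gcd_eq_gcd_ab, hg]; rfl⟩
  have hab' : (m : ℝ) * a + n * b = 1 := by exact_mod_cast hab
  obtain ⟨e, he⟩ : ∃ e : ℤ, (e : ℝ) * wedge v w = |wedge v w| := by
    rcases le_total 0 (wedge v w) with h | h
    · exact ⟨1, by rw [abs_of_nonneg h]; simp⟩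
    · exact ⟨-1, by rw [abs_of_nonpos h]; simp⟩
  set p := (m : ℝ) • v + (n : ℝ) • w with hp
  set q := ((-(e * b) : ℤ) : ℝ) • v + ((e * a : ℤ) : ℝ) • w with hq
  have hpq : wedge p q = |wedge v w| := by
    rw [← he, hp, hq, wedge_add_left, wedge_smul_left, wedge_smul_left, wedge_add_right,
      wedge_add_right, wedge_smul_right, wedge_smul_right, wedge_smul_right, wedge_smul_right,
      wedge_self, wedge_self, wedge_swap w v]
    push_cast
    linear_combination (e : ℝ) * wedge v w * hab'
  refine ⟨p, q, hpq ▸ abs_pos.2 hvw, hpq, ⟨m, n, hmn, rfl⟩, fun k => ?_⟩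
  have hrep : q + (k : ℝ) • p =
      ((-(e * b) + k * m : ℤ) : ℝ) • v + ((e * a + k * n : ℤ) : ℝ) • w := by
    rw [hp, hq]
    push_cast
    module
  rw [hrep]
  apply hmin'
  by_contra! h
  rw [h.1, h.2] at hrep
  have h1 : wedge p (q + (k : ℝ) • p) = 0 := by
    rw [hrep]; simp [wedge]
  rw [wedge_add_right, wedge_smul_right, wedge_self, mul_zero, add_zero, hpq] at h1
  exact hvw (abs_eq_zero.1 h1)

/-- Every admissible lattice of `K'` can be replaced by one of `K` that is at least as dense. -/
def Dominated (K K' : Set (ℝ × ℝ)) : Prop :=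
  ∀ v w : ℝ × ℝ, wedge v w ≠ 0 → Admissible K' v w →
    ∃ v' w' : ℝ × ℝ, wedge v' w' ≠ 0 ∧ Admissible K v' w' ∧ |wedge v' w'| ≤ |wedge v w|

/-- There is a smaller domain whose lattice packings are no better. -/
def Improvable (K : Set (ℝ × ℝ)) : Prop :=
  ∃ K' : Set (ℝ × ℝ), IsCSCD K' ∧ volume K' < volume K ∧ Dominated K K'

/-- The covolume of an admissible lattice is at least that of some inscribed hexagon with vertex
at a normalized shortest vector. -/
lemma exists_hexagon_le {K : Set (ℝ × ℝ)} (hK : IsCSCD K) {v w : ℝ × ℝ}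
    (hvw : wedge v w ≠ 0) (hadm : Admissible K v w) :
    ∃ p ∈ frontier K, ∀ s ∈ K, s + p ∈ K → wedge p s ≤ |wedge v w| := by
  obtain ⟨p, q, hpq0, hpq, ⟨m, n, hmn, hpmn⟩, hmin⟩ := exists_shortest_basis hK hvw
  set μ := gauge K p with hμ
  have hμ1 : 1 ≤ μ := by
    have := hadm m n hmn
    rw [← hpmn, hK.mem_interior_iff, not_lt] at this
    exact this
  have hμ0 : 0 < μ := by linarith
  have hp1 : μ⁻¹ • p ∈ frontier K := by
    rw [hK.mem_frontier_iff, hK.gauge_real_smul, abs_of_pos (inv_pos.2 hμ0),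
      inv_mul_cancel₀ hμ0.ne']
  refine ⟨μ⁻¹ • p, hp1, fun s hs hsp => ?_⟩
  by_contra! hlt
  have hw1 : wedge (μ⁻¹ • p) (μ⁻¹ • q) = μ⁻¹ * μ⁻¹ * wedge p q := by
    rw [wedge_smul_left, wedge_smul_right]; ring
  have hi0 : 0 < μ⁻¹ := inv_pos.2 hμ0
  have hi1 : μ⁻¹ ≤ 1 := inv_le_one_of_one_le₀ hμ1
  have hle : wedge (μ⁻¹ • p) (μ⁻¹ • q) ≤ |wedge v w| := by
    rw [hw1, ← hpq]
    have : μ⁻¹ * μ⁻¹ ≤ 1 := by nlinarith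
    nlinarith
  have hpos : 0 < wedge (μ⁻¹ • p) (μ⁻¹ • q) := by rw [hw1]; positivity
  obtain ⟨k, hk⟩ := exists_translate_mem_interior hK (hK.frontier_iff.1 hp1).1 hs hsp hpos
    (hle.trans_lt hlt)
  rw [smul_comm, ← smul_add, hK.mem_interior_iff, hK.gauge_real_smul, abs_of_pos hi0,
    inv_mul_lt_iff₀ hμ0, mul_one] at hk
  exact absurd (hmin k) (not_le.2 hk)

/-- If the boundary of `K'` consists of boundary points of `K` and of vertices of inscribed
hexagons with the area of a given hexagon inscribed in `K`, then `K'` has no better packings. -/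
lemma dominated_of_hexagons {K K' : Set (ℝ × ℝ)} (hK : IsCSCD K) (hK' : IsCSCD K') {D : ℝ}
    (hD : 0 < D) (h : ∀ x ∈ frontier K', x ∈ frontier K ∨
      ∃ s ∈ K', s + x ∈ K' ∧ wedge x s = D) {p s : ℝ × ℝ} (hp : p ∈ frontier K)
    (hs : s ∈ frontier K) (hsp : s + p ∈ frontier K) (hps : wedge p s = D) :
    Dominated K K' := by
  intro v w hvw hadm
  obtain ⟨p1, hp1, hmax⟩ := exists_hexagon_le hK' hvw hadm
  obtain ⟨s1, hs1, hsp1, hpos⟩ := exists_hexagon hK' hp1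
  have hp1' := hK'.frontier_iff.1 hp1
  have hs1' := hK'.frontier_iff.1 hs1
  have hsp1' := hK'.frontier_iff.1 hsp1
  have h1 := hmax s1 hs1'.1 hsp1'.1
  by_cases hDle : D ≤ wedge p1 s1
  · refine ⟨p, s, by rw [hps]; exact hD.ne', admissible_of_hexagon hK hp hs hsp, ?_⟩
    rw [hps, abs_of_pos hD]
    exact hDle.trans h1
  · have hcase : ∀ x y, x ∈ frontier K' → y ∈ frontier K' → y + x ∈ frontier K' →
        wedge x y = wedge p1 s1 → x ∈ frontier K := by
      intro x y hx hy hyx hxy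
      rcases h x hx with h | ⟨t, ht, htx, hxt⟩
      · exact h
      · exfalso
        apply hDle
        rw [← hxt, ← hxy]
        exact wedge_le_of_hexagon hK' (hK'.frontier_iff.1 hx).1 ht htx hy hyx (hxy ▸ hpos)
    have f1 := hcase p1 s1 hp1 hs1 hsp1 rfl
    have f2 := hcase s1 (-(s1 + p1)) hs1 (hK'.neg_frontier hsp1)
      (by convert hK'.neg_frontier hp1 using 1; abel)
      (by simp only [wedge, Prod.fst_neg, Prod.snd_neg, Prod.fst_add, Prod.snd_add]; ring)
    have f3 := hcase (s1 + p1) (-p1) hsp1 (hK'.neg_frontier hp1)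
      (by convert hs1 using 1; abel)
      (by simp only [wedge, Prod.fst_neg, Prod.snd_neg, Prod.fst_add, Prod.snd_add]; ring)
    refine ⟨p1, s1, hpos.ne', admissible_of_hexagon hK f1 f2 f3, ?_⟩
    rw [abs_of_pos hpos]
    exact h1

/-! ### Miserly domains cannot be improved -/

/-- The covolume of admissible lattices is bounded below. -/
lemma exists_covolume_bound {K : Set (ℝ × ℝ)} (hK : IsCSCD K) :
    ∃ c > 0, ∀ v w : ℝ × ℝ, wedge v w ≠ 0 → Admissible K v w → c ≤ |wedge v w| := by
  obtain ⟨ε, hε, hball⟩ := Metric.mem_nhds_iff.1 hK.nhds_zero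
  refine ⟨(ε / 2) ^ 2 / 2, by positivity, fun v w hvw hadm => ?_⟩
  obtain ⟨p, hp, hmax⟩ := exists_hexagon_le hK hvw hadm
  have hpK := (hK.frontier_iff.1 hp).1
  have hbox : ∀ a b : ℝ, |a| ≤ ε / 2 → |b| ≤ ε / 2 → ((a, b) : ℝ × ℝ) ∈ K := by
    intro a b ha hb
    apply hball
    rw [mem_ball_zero_iff, Prod.norm_def, Real.norm_eq_abs, Real.norm_eq_abs]
    exact max_lt (by linarith) (by linarith)
  have hbox' : ∀ a b : ℝ, |a| < ε → |b| < ε → ((a, b) : ℝ × ℝ) ∈ interior K := by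
    intro a b ha hb
    rw [mem_interior]
    refine ⟨_, hball, Metric.isOpen_ball, ?_⟩
    rw [mem_ball_zero_iff, Prod.norm_def, Real.norm_eq_abs, Real.norm_eq_abs]
    exact max_lt ha hb
  have hcand : ∀ u ∈ K, wedge p u / 2 ≤ |wedge v w| := by
    intro u hu
    have h1 : (1 / 2 : ℝ) • u + (-(1 / 2) : ℝ) • p ∈ K :=
      hK.combo_mem hu hpK (by norm_num [abs_of_pos])
    have h2 : (1 / 2 : ℝ) • u + (-(1 / 2) : ℝ) • p + p ∈ K := by
      have := hK.combo_mem hu hpK (a := 1 / 2) (b := 1 / 2) (by norm_num [abs_of_pos])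
      convert this using 1
      module
    have := hmax _ h1 h2
    rw [wedge_add_right, wedge_smul_right, wedge_smul_right, wedge_self] at this
    linarith
  have e0 : |ε / 2| ≤ ε / 2 := by rw [abs_of_pos (by positivity)]
  have e1 : |-(ε / 2)| ≤ ε / 2 := by rw [abs_neg]; exact e0
  have e2 : |(0 : ℝ)| ≤ ε / 2 := by rw [abs_zero]; positivity
  have a1 := hcand _ (hbox 0 (ε / 2) e2 e0)
  have a2 := hcand _ (hbox 0 (-(ε / 2)) e2 e1)
  have a3 := hcand _ (hbox (ε / 2) 0 e0 e2)
  have a4 := hcand _ (hbox (-(ε / 2)) 0 e1 e2)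
  by_contra! hlt
  clear hmax hcand
  generalize |wedge v w| = W at *
  simp only [wedge] at a1 a2 a3 a4
  have b1 : |p.1| < ε := by
    rw [abs_lt]; constructor <;> nlinarith
  have b2 : |p.2| < ε := by
    rw [abs_lt]; constructor <;> nlinarith
  exact (hK.frontier_iff.1 hp).2 (hbox' p.1 p.2 b1 b2)

lemma abs_wedge_half (v w : ℝ × ℝ) :
    |wedge ((1 / 2 : ℝ) • v) ((1 / 2 : ℝ) • w)| = |wedge v w| / 4 := by
  rw [wedge_smul_left, wedge_smul_right, ← mul_assoc, abs_mul]
  norm_num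
  ring

lemma volume_pos_of_isCSCD {K : Set (ℝ × ℝ)} (hK : IsCSCD K) : 0 < (volume K).toReal :=
  ENNReal.toReal_pos ((isOpen_interior.measure_pos volume hK.2.2.1).trans_le
    (measure_mono interior_subset)).ne' hK.2.1.measure_lt_top.ne

lemma bddAbove_packingDensities {K : Set (ℝ × ℝ)} (hK : IsCSCD K) :
    BddAbove (packingDensities K) := by
  obtain ⟨c, hc, h⟩ := exists_covolume_bound hK
  refine ⟨(volume K).toReal / (4 * c), ?_⟩
  rintro d ⟨v, w, hvw, hpack, rfl⟩
  rw [isPacking_iff_admissible hK hvw] at hpack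
  have h1 := h _ _ (by
    rw [wedge_smul_left, wedge_smul_right]; simpa using hvw) hpack
  rw [abs_wedge_half] at h1
  exact div_le_div_of_nonneg_left ENNReal.toReal_nonneg (by positivity) (by linarith)

lemma exists_isPacking {K : Set (ℝ × ℝ)} (hK : IsCSCD K) :
    ∃ v w : ℝ × ℝ, wedge v w ≠ 0 ∧ IsPacking K (latticeOf v w) := by
  obtain ⟨p, hp⟩ : (frontier K).Nonempty := by
    refine ⟨(gauge K (1, 0))⁻¹ • (1, 0), ?_⟩
    have h0 : 0 < gauge K (1, 0) := hK.gauge_pos' (by simp)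
    rw [hK.mem_frontier_iff, hK.gauge_real_smul, abs_of_pos (inv_pos.2 h0),
      inv_mul_cancel₀ h0.ne']
  obtain ⟨s, hs, hsp, hpos⟩ := exists_hexagon hK hp
  have hne : wedge ((2 : ℝ) • p) ((2 : ℝ) • s) ≠ 0 := by
    rw [wedge_smul_left, wedge_smul_right]
    positivity
  refine ⟨(2 : ℝ) • p, (2 : ℝ) • s, hne, ?_⟩
  rw [isPacking_iff_admissible hK hne, smul_smul, smul_smul]
  norm_num
  exact admissible_of_hexagon hK hp hs hsp

lemma not_improvable_of_isMiserly {K : Set (ℝ × ℝ)} (hK : IsMiserly K) : ¬ Improvable K := by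
  rintro ⟨K', hK', hvol, hdom⟩
  have hV := volume_pos_of_isCSCD hK.1
  have hV' := volume_pos_of_isCSCD hK'
  have hlt : (volume K').toReal < (volume K).toReal :=
    ENNReal.toReal_strict_mono hK.1.2.1.measure_lt_top.ne hvol
  have hpos : 0 < deltaLat K := by
    obtain ⟨v, w, hvw, hpack⟩ := exists_isPacking hK.1
    have := le_csSup (bddAbove_packingDensities hK.1) ⟨v, w, hvw, hpack, rfl⟩
    have h2 : 0 < (volume K).toReal / |wedge v w| := div_pos hV (abs_pos.2 hvw)
    exact h2.trans_le this
  have hle : deltaLat K' ≤ (volume K').toReal / (volume K).toReal * deltaLat K := by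
    refine csSup_le ?_ ?_
    · obtain ⟨v, w, hvw, hpack⟩ := exists_isPacking hK'
      exact ⟨_, v, w, hvw, hpack, rfl⟩
    · rintro d ⟨v, w, hvw, hpack, rfl⟩
      rw [isPacking_iff_admissible hK' hvw] at hpack
      obtain ⟨v', w', hne, hadm, hcov⟩ := hdom _ _ (by
        rw [wedge_smul_left, wedge_smul_right]; simpa using hvw) hpack
      rw [abs_wedge_half] at hcov
      have hne2 : wedge ((2 : ℝ) • v') ((2 : ℝ) • w') ≠ 0 := by
        rw [wedge_smul_left, wedge_smul_right]; simpa using hne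
      have hpack' : IsPacking K (latticeOf ((2 : ℝ) • v') ((2 : ℝ) • w')) := by
        rw [isPacking_iff_admissible hK.1 hne2, smul_smul, smul_smul]
        norm_num
        exact hadm
      have h1 := le_csSup (bddAbove_packingDensities hK.1)
        ⟨(2 : ℝ) • v', (2 : ℝ) • w', hne2, hpack', rfl⟩
      have h2 : |wedge ((2 : ℝ) • v') ((2 : ℝ) • w')| ≤ |wedge v w| := by
        rw [wedge_smul_left, wedge_smul_right, ← mul_assoc, abs_mul]
        norm_num
        linarith
      have h3 : (volume K).toReal / |wedge v w| ≤ deltaLat K :=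
        (div_le_div_of_nonneg_left hV.le (abs_pos.2 hne2) h2).trans h1
      calc (volume K').toReal / |wedge v w|
          = (volume K').toReal / (volume K).toReal * ((volume K).toReal / |wedge v w|) := by
            field_simp
        _ ≤ _ := mul_le_mul_of_nonneg_left h3 (by positivity)
  have h4 : (volume K').toReal / (volume K).toReal < 1 := (div_lt_one hV).2 hlt
  have h5 := hK.2 K' hK'
  nlinarith

/-! ### Linear changes of coordinates -/

lemma isCSCD_preimage {K : Set (ℝ × ℝ)} (hK : IsCSCD K) (T : (ℝ × ℝ) ≃L[ℝ] ℝ × ℝ) :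
    IsCSCD (T ⁻¹' K) := by
  refine ⟨hK.1.linear_preimage (T : (ℝ × ℝ) →ₗ[ℝ] ℝ × ℝ), ?_, ?_, ?_⟩
  · exact T.toHomeomorph.isClosedEmbedding.isCompact_preimage hK.2.1
  · refine ⟨0, ?_⟩
    have := T.toHomeomorph.preimage_interior K
    change _ ∈ interior (T.toHomeomorph ⁻¹' K)
    rw [← this]
    simpa using hK.zero_mem_interior
  · ext x
    simp [hK.neg_mem_iff]

lemma wedge_map (T : (ℝ × ℝ) ≃L[ℝ] ℝ × ℝ) (x y : ℝ × ℝ) :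
    wedge (T x) (T y) = wedge (T (1, 0)) (T (0, 1)) * wedge x y := by
  have key : ∀ a : ℝ × ℝ, T a = a.1 • T (1, 0) + a.2 • T (0, 1) := by
    intro a
    have : a = a.1 • ((1, 0) : ℝ × ℝ) + a.2 • ((0, 1) : ℝ × ℝ) := by ext <;> simp
    conv_lhs => rw [this]
    rw [map_add, map_smul, map_smul]
  rw [key x, key y, wedge_add_left, wedge_smul_left, wedge_smul_left, wedge_add_right,
    wedge_add_right, wedge_smul_right, wedge_smul_right, wedge_smul_right, wedge_smul_right,
    wedge_self, wedge_self, wedge_swap (T (0, 1)) (T (1, 0))]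
  simp only [wedge]
  ring

lemma wedge_map_ne_zero (T : (ℝ × ℝ) ≃L[ℝ] ℝ × ℝ) : wedge (T (1, 0)) (T (0, 1)) ≠ 0 := by
  intro h
  have := wedge_map T (T.symm (1, 0)) (T.symm (0, 1))
  rw [h] at this
  simp [wedge] at this

lemma admissible_preimage_iff {K : Set (ℝ × ℝ)} (T : (ℝ × ℝ) ≃L[ℝ] ℝ × ℝ) (v w : ℝ × ℝ) :
    Admissible (T ⁻¹' K) v w ↔ Admissible K (T v) (T w) := by
  have h : interior (T ⁻¹' K) = T ⁻¹' interior K := (T.toHomeomorph.preimage_interior K).symm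
  unfold Admissible
  rw [h]
  simp only [mem_preimage, map_add, map_smul]

lemma Dominated.preimage {K K' : Set (ℝ × ℝ)} (h : Dominated K K')
    (T : (ℝ × ℝ) ≃L[ℝ] ℝ × ℝ) : Dominated (T ⁻¹' K) (T ⁻¹' K') := by
  intro v w hvw hadm
  rw [admissible_preimage_iff] at hadm
  obtain ⟨v', w', hne, hadm', hle⟩ := h (T v) (T w)
    (by rw [wedge_map]; exact mul_ne_zero (wedge_map_ne_zero T) hvw) hadm
  refine ⟨T.symm v', T.symm w', ?_, ?_, ?_⟩
  · rw [wedge_map]; exact mul_ne_zero (wedge_map_ne_zero _) hne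
  · rw [admissible_preimage_iff]; simpa using hadm'
  · have h1 := wedge_map T (T.symm v') (T.symm w')
    rw [T.apply_symm_apply, T.apply_symm_apply] at h1
    rw [h1, wedge_map T v w, abs_mul, abs_mul] at hle
    exact le_of_mul_le_mul_left hle (abs_pos.2 (wedge_map_ne_zero T))

lemma Improvable.preimage {K : Set (ℝ × ℝ)} (h : Improvable K) (T : (ℝ × ℝ) ≃L[ℝ] ℝ × ℝ) :
    Improvable (T ⁻¹' K) := by
  obtain ⟨K', hK', hvol, hdom⟩ := h
  refine ⟨T ⁻¹' K', isCSCD_preimage hK' T, ?_, hdom.preimage T⟩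
  rw [Measure.addHaar_preimage_continuousLinearEquiv,
    Measure.addHaar_preimage_continuousLinearEquiv]
  refine ENNReal.mul_lt_mul_right ?_ ENNReal.ofReal_ne_top hvol
  simp only [ne_eq, ENNReal.ofReal_eq_zero, not_le, abs_pos]
  exact (LinearEquiv.isUnit_det' T.symm.toLinearEquiv).ne_zero

/-- Undo a linear change of coordinates. -/
lemma improvable_of_preimage {K : Set (ℝ × ℝ)} (T : (ℝ × ℝ) ≃L[ℝ] ℝ × ℝ)
    (h : Improvable (T ⁻¹' K)) : Improvable K := by
  have := h.preimage T.symm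
  rwa [← preimage_comp, show (T ∘ T.symm : ℝ × ℝ → ℝ × ℝ) = id from
    funext T.apply_symm_apply, preimage_id] at this

lemma mem_frontier_preimage {K : Set (ℝ × ℝ)} (T : (ℝ × ℝ) ≃L[ℝ] ℝ × ℝ) {x : ℝ × ℝ} :
    x ∈ frontier (T ⁻¹' K) ↔ T x ∈ frontier K := by
  have h : frontier (T ⁻¹' K) = T ⁻¹' frontier K := (T.toHomeomorph.preimage_frontier K).symm
  rw [h, mem_preimage]

/-- Coordinates with respect to the basis `p`, `v`. -/
def basisEquiv (p v : ℝ × ℝ) (h : wedge p v ≠ 0) : (ℝ × ℝ) ≃L[ℝ] ℝ × ℝ :=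
  LinearEquiv.toContinuousLinearEquiv
    { toFun := fun x => x.1 • p + x.2 • v
      map_add' := fun x y => by
        simp only [Prod.fst_add, Prod.snd_add]; module
      map_smul' := fun c x => by
        simp only [Prod.smul_fst, Prod.smul_snd, smul_eq_mul, RingHom.id_apply]; module
      invFun := fun x => (wedge x v / wedge p v, wedge p x / wedge p v)
      left_inv := fun x => by
        ext
        · simp only [wedge_add_left, wedge_smul_left, wedge_self, mul_zero, add_zero]
          exact mul_div_cancel_right₀ _ h
        · simp only [wedge_add_right, wedge_smul_right, wedge_self, mul_zero, zero_add]
          exact mul_div_cancel_right₀ _ h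
      right_inv := fun x => by
        simp only [div_eq_inv_mul, ← smul_smul]
        rw [← smul_add, ← wedge_smul_eq, smul_smul, inv_mul_cancel₀ h, one_smul] }

lemma basisEquiv_apply (p v : ℝ × ℝ) (h : wedge p v ≠ 0) (x : ℝ × ℝ) :
    basisEquiv p v h x = x.1 • p + x.2 • v := rfl

/-! ### Replacing a boundary arc -/

/-- The point at position `z` on the line of slope `r` through `(0, D)`, oriented by `κ`. -/
def rayPoint (D κ r z : ℝ) : ℝ × ℝ := (κ * z, D + κ * (z * r))

/-- The tangent functional at slope `ρ` of the curve `r ↦ rayPoint D κ r (N r)⁻¹`, where `M` is the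
derivative of `N`. -/
def tangentFun (D κ : ℝ) (N M : ℝ → ℝ) (ρ : ℝ) (x : ℝ × ℝ) : ℝ :=
  N ρ * (κ * x.1) + M ρ * (κ * (x.2 - D) - ρ * (κ * x.1))

/-- The functional equal to one on the chord of the curve between the slopes `a` and `b`. -/
def secantFun (D κ a b : ℝ) (N : ℝ → ℝ) (x : ℝ × ℝ) : ℝ :=
  N a * (κ * x.1) + (N b - N a) / (b - a) * (κ * (x.2 - D) - a * (κ * x.1))

/-- The region between the chord and the curve. -/
def arcCap (D κ a b : ℝ) (N M : ℝ → ℝ) : Set (ℝ × ℝ) :=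
  {x | 1 ≤ secantFun D κ a b N x ∧ ∀ ρ ∈ Icc a b, tangentFun D κ N M ρ x ≤ 1}

/-- The sector with apex `(0, D)` between the slopes `a` and `b`. -/
def sector (D κ a b : ℝ) : Set (ℝ × ℝ) :=
  {x | 0 < κ * x.1 ∧ a * (κ * x.1) ≤ κ * (x.2 - D) ∧ κ * (x.2 - D) ≤ b * (κ * x.1)}

/-- The strictly convex profiles `N` with derivative `M` on `[a, b]`. -/
structure IsProfile (a b : ℝ) (N M : ℝ → ℝ) : Prop where
  lt : a < b
  pos : ∀ r ∈ Icc a b, 0 < N r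
  tangent_lt : ∀ ρ ∈ Icc a b, ∀ r ∈ Icc a b, ρ ≠ r → N ρ + M ρ * (r - ρ) < N r
  left : 0 < N a + M a * (b - a)
  right : 0 < N b + M b * (a - b)

/-- Cut off the chord between the slopes `a` and `b` and its antipode, and glue the caps. -/
def replaceArc (K : Set (ℝ × ℝ)) (D κ a b : ℝ) (N M : ℝ → ℝ) : Set (ℝ × ℝ) :=
  {x | x ∈ K ∧ secantFun D κ a b N x ≤ 1 ∧ secantFun D κ a b N (-x) ≤ 1} ∪
    arcCap D κ a b N M ∪ {x | -x ∈ arcCap D κ a b N M}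

lemma Convex.union_of_cut {K C H : Set (ℝ × ℝ)} (hK : Convex ℝ K) (hC : Convex ℝ C)
    (hH : Convex ℝ H) {L : ℝ × ℝ → ℝ}
    (hL : ∀ x y : ℝ × ℝ, ∀ s t : ℝ, s + t = 1 → L (s • x + t • y) = s * L x + t * L y)
    (hCL : ∀ x ∈ C, 1 ≤ L x) (hKH : K ⊆ H) (hCH : C ⊆ H)
    (hcut : ∀ x ∈ H, L x = 1 → x ∈ K ∧ x ∈ C) : Convex ℝ ({x | x ∈ K ∧ L x ≤ 1} ∪ C) := by
  have main : ∀ x y, x ∈ K → L x ≤ 1 → y ∈ C → ∀ s t : ℝ, 0 ≤ s → 0 ≤ t → s + t = 1 →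
      s • x + t • y ∈ {x | x ∈ K ∧ L x ≤ 1} ∪ C := by
    intro x y hx hxL hy s t hs ht hst
    have hy1 := hCL y hy
    rcases eq_or_lt_of_le hxL with h | h
    · exact Or.inr (hC (hcut x (hKH hx) h).2 hy hs ht hst)
    · have hd : 0 < L y - L x := by linarith
      set u := (1 - L x) / (L y - L x) with hu
      have hu0 : 0 < u := div_pos (by linarith) hd
      have hu1 : u ≤ 1 := (div_le_one hd).2 (by linarith)
      have hud : u * (L y - L x) = 1 - L x := div_mul_cancel₀ _ hd.ne'
      set z := (1 - u) • x + u • y with hz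
      have hzH : z ∈ H := hH (hKH hx) (hCH hy) (by linarith) hu0.le (by ring)
      have hzL : L z = 1 := by rw [hz, hL _ _ _ _ (by ring)]; linarith
      obtain ⟨hzK, hzC⟩ := hcut z hzH hzL
      rcases le_or_gt t u with htu | htu
      · left
        have hrep : s • x + t • y = (1 - t / u) • x + (t / u) • z := by
          rw [hz]
          have : s = 1 - t := by linarith
          rw [this]
          match_scalars <;> field_simp
          ring
        constructor
        · rw [hrep]
          exact hK hx hzK (by rw [sub_nonneg]; exact (div_le_one hu0).2 htu)
            (by positivity) (by ring)
        · rw [hL _ _ _ _ hst]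
          have : s = 1 - t := by linarith
          rw [this]
          nlinarith
      · right
        have hu1' : 0 < 1 - u := by linarith
        have hrep : s • x + t • y = (s / (1 - u)) • z + (1 - s / (1 - u)) • y := by
          rw [hz]
          have : t = 1 - s := by linarith
          rw [this]
          match_scalars <;> field_simp
          ring
        rw [hrep]
        exact hC hzC hy (by positivity)
          (by rw [sub_nonneg]; exact (div_le_one hu1').2 (by linarith)) (by ring)
  intro x hx y hy s t hs ht hst
  rcases hx with hx | hx <;> rcases hy with hy | hy
  · left
    refine ⟨hK hx.1 hy.1 hs ht hst, ?_⟩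
    rw [hL _ _ _ _ hst]
    have h1 := hx.2
    have h2 := hy.2
    nlinarith
  · exact main x y hx.1 hx.2 hy s t hs ht hst
  · rw [add_comm]
    exact main y x hy.1 hy.2 hx t s ht hs (by linarith)
  · exact Or.inr (hC hx hy hs ht hst)

lemma tangentFun_combo (D κ : ℝ) (N M : ℝ → ℝ) (ρ : ℝ) (x y : ℝ × ℝ) {s t : ℝ}
    (h : s + t = 1) : tangentFun D κ N M ρ (s • x + t • y) =
      s * tangentFun D κ N M ρ x + t * tangentFun D κ N M ρ y := by
  obtain rfl : s = 1 - t := by linarith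
  simp only [tangentFun, Prod.fst_add, Prod.snd_add, Prod.smul_fst, Prod.smul_snd, smul_eq_mul]
  ring

lemma secantFun_combo (D κ a b : ℝ) (N : ℝ → ℝ) (x y : ℝ × ℝ) {s t : ℝ}
    (h : s + t = 1) : secantFun D κ a b N (s • x + t • y) =
      s * secantFun D κ a b N x + t * secantFun D κ a b N y := by
  obtain rfl : s = 1 - t := by linarith
  simp only [secantFun, Prod.fst_add, Prod.snd_add, Prod.smul_fst, Prod.smul_snd, smul_eq_mul]
  ring

lemma continuous_tangentFun (D κ : ℝ) (N M : ℝ → ℝ) (ρ : ℝ) :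
    Continuous (tangentFun D κ N M ρ) := by
  unfold tangentFun; fun_prop

lemma continuous_secantFun (D κ a b : ℝ) (N : ℝ → ℝ) : Continuous (secantFun D κ a b N) := by
  unfold secantFun; fun_prop

lemma convex_tangentFun_le (D κ : ℝ) (N M : ℝ → ℝ) (ρ : ℝ) :
    Convex ℝ {x | tangentFun D κ N M ρ x ≤ 1} := by
  intro x hx y hy s t hs ht hst
  simp only [mem_ofPred_eq] at hx hy ⊢
  rw [tangentFun_combo _ _ _ _ _ _ _ hst]
  nlinarith

lemma convex_arcCap (D κ a b : ℝ) (N M : ℝ → ℝ) : Convex ℝ (arcCap D κ a b N M) := by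
  rintro x ⟨hx, hx'⟩ y ⟨hy, hy'⟩ s t hs ht hst
  refine ⟨?_, fun ρ hρ => convex_tangentFun_le D κ N M ρ (hx' ρ hρ) (hy' ρ hρ) hs ht hst⟩
  rw [secantFun_combo _ _ _ _ _ _ _ hst]
  nlinarith

lemma isClosed_arcCap (D κ a b : ℝ) (N M : ℝ → ℝ) : IsClosed (arcCap D κ a b N M) := by
  have : arcCap D κ a b N M = {x | 1 ≤ secantFun D κ a b N x} ∩
      ⋂ ρ ∈ Icc a b, {x | tangentFun D κ N M ρ x ≤ 1} := by
    ext x; simp [arcCap]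
  rw [this]
  exact (isClosed_le continuous_const (continuous_secantFun D κ a b N)).inter
    (isClosed_biInter fun ρ _ => isClosed_le (continuous_tangentFun D κ N M ρ) continuous_const)

lemma tangentFun_rayPoint {D κ : ℝ} (hκ : κ * κ = 1) (N M : ℝ → ℝ) (ρ r z : ℝ) :
    tangentFun D κ N M ρ (rayPoint D κ r z) = z * (N ρ + M ρ * (r - ρ)) := by
  simp only [tangentFun, rayPoint]
  linear_combination (z * (N ρ + M ρ * (r - ρ))) * hκ

lemma secantFun_rayPoint {D κ : ℝ} (hκ : κ * κ = 1) (a b : ℝ) (N : ℝ → ℝ) (r z : ℝ) :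
    secantFun D κ a b N (rayPoint D κ r z) =
      z * (N a + (N b - N a) / (b - a) * (r - a)) := by
  simp only [secantFun, rayPoint]
  linear_combination (z * (N a + (N b - N a) / (b - a) * (r - a))) * hκ

/-- Every point of the sector lies on a ray. -/
lemma exists_rayPoint_of_mem_sector {D κ a b : ℝ} (hκ : κ * κ = 1) {x : ℝ × ℝ}
    (hx : x ∈ sector D κ a b) : ∃ r ∈ Icc a b, ∃ z > 0, x = rayPoint D κ r z := by
  obtain ⟨h1, h2, h3⟩ := hx
  refine ⟨κ * (x.2 - D) / (κ * x.1), ⟨(le_div_iff₀ h1).2 h2, (div_le_iff₀ h1).2 h3⟩,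
    κ * x.1, h1, ?_⟩
  simp only [rayPoint]
  rw [mul_div_cancel₀ _ h1.ne']
  ext <;> simp only
  · linear_combination (-x.1) * hκ
  · linear_combination (D - x.2) * hκ

namespace IsProfile

variable {a b : ℝ} {N M : ℝ → ℝ}

lemma a_mem (h : IsProfile a b N M) : a ∈ Icc a b := ⟨le_rfl, h.lt.le⟩

lemma b_mem (h : IsProfile a b N M) : b ∈ Icc a b := ⟨h.lt.le, le_rfl⟩

lemma tangent_le (h : IsProfile a b N M) {ρ r : ℝ} (hρ : ρ ∈ Icc a b) (hr : r ∈ Icc a b) :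
    N ρ + M ρ * (r - ρ) ≤ N r := by
  rcases eq_or_ne ρ r with rfl | hne
  · simp
  · exact (h.tangent_lt ρ hρ r hr hne).le

lemma left_lt (h : IsProfile a b N M) : M a < (N b - N a) / (b - a) := by
  have := h.tangent_lt a h.a_mem b h.b_mem h.lt.ne
  rw [lt_div_iff₀ (sub_pos.2 h.lt)]
  linarith

lemma lt_right (h : IsProfile a b N M) : (N b - N a) / (b - a) < M b := by
  have := h.tangent_lt b h.b_mem a h.a_mem h.lt.ne'
  rw [div_lt_iff₀ (sub_pos.2 h.lt)]
  linarith

lemma slope_mul (h : IsProfile a b N M) : (N b - N a) / (b - a) * (b - a) = N b - N a :=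
  div_mul_cancel₀ _ (sub_pos.2 h.lt).ne'

lemma secant_eq (h : IsProfile a b N M) (D κ : ℝ) (x : ℝ × ℝ) : secantFun D κ a b N x =
    N b * (κ * x.1) + (N b - N a) / (b - a) * (κ * (x.2 - D) - b * (κ * x.1)) := by
  simp only [secantFun]
  linear_combination (κ * x.1) * h.slope_mul

/-- The profile lies below its secant. -/
lemma le_secant (h : IsProfile a b N M) {r : ℝ} (hr : r ∈ Icc a b) :
    N r ≤ N a + (N b - N a) / (b - a) * (r - a) := by
  have h1 := h.tangent_le hr h.a_mem
  have h2 := h.tangent_le hr h.b_mem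
  have hd := sub_pos.2 h.lt
  have hm := h.slope_mul
  have h3 : (b - a) * N r ≤ (b - a) * (N a + (N b - N a) / (b - a) * (r - a)) := by
    have e : (b - a) * (N a + (N b - N a) / (b - a) * (r - a)) =
        (b - r) * N a + (r - a) * N b := by
      linear_combination (r - a) * hm
    rw [e]
    have h4 := mul_le_mul_of_nonneg_left h1 (sub_nonneg.2 hr.2)
    have h5 := mul_le_mul_of_nonneg_left h2 (sub_nonneg.2 hr.1)
    linarith
  exact le_of_mul_le_mul_left h3 hd

lemma left_nonneg (h : IsProfile a b N M) {r : ℝ} (hr : r ∈ Icc a b) : 0 ≤ N a + M a * (r - a) := by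
  have h1 := h.left
  have h2 := h.pos a h.a_mem
  have hd := sub_pos.2 h.lt
  have h3 : 0 ≤ (b - a) * (N a + M a * (r - a)) := by
    have e : (b - a) * (N a + M a * (r - a)) =
        (r - a) * (N a + M a * (b - a)) + (b - r) * N a := by ring
    rw [e]
    have := mul_nonneg (sub_nonneg.2 hr.1) h1.le
    have := mul_nonneg (sub_nonneg.2 hr.2) h2.le
    linarith
  exact nonneg_of_mul_nonneg_right h3 hd

lemma right_nonneg (h : IsProfile a b N M) {r : ℝ} (hr : r ∈ Icc a b) :
    0 ≤ N b + M b * (r - b) := by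
  have h1 := h.right
  have h2 := h.pos b h.b_mem
  have hd := sub_pos.2 h.lt
  have h3 : 0 ≤ (b - a) * (N b + M b * (r - b)) := by
    have e : (b - a) * (N b + M b * (r - b)) =
        (b - r) * (N b + M b * (a - b)) + (r - a) * N b := by ring
    rw [e]
    have := mul_nonneg (sub_nonneg.2 hr.2) h1.le
    have := mul_nonneg (sub_nonneg.2 hr.1) h2.le
    linarith
  exact nonneg_of_mul_nonneg_right h3 hd

/-- A point beyond the chord and inside the extreme tangents lies in the sector. -/
lemma mem_sector (h : IsProfile a b N M) {D κ : ℝ} {x : ℝ × ℝ} (hs : 1 ≤ secantFun D κ a b N x)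
    (ha : tangentFun D κ N M a x ≤ 1) (hb : tangentFun D κ N M b x ≤ 1) :
    x ∈ sector D κ a b := by
  have hs' := hs
  rw [h.secant_eq] at hs'
  simp only [secantFun, tangentFun] at hs ha hb
  have h1 := h.left_lt
  have h2 := h.lt_right
  have hab := h.lt
  set m := (N b - N a) / (b - a) with hm
  set q1 := κ * x.1 with hq1
  set q2 := κ * (x.2 - D) with hq2
  have h3 : a * q1 ≤ q2 := by
    by_contra! hc
    nlinarith
  have h4 : q2 ≤ b * q1 := by
    by_contra! hc
    nlinarith
  refine ⟨?_, h3, h4⟩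
  by_contra! hc
  change q1 ≤ 0 at hc
  rcases eq_or_lt_of_le hc with hc | hc
  · rw [hc] at hs h3 h4
    have : q2 = 0 := by linarith
    rw [this] at hs
    norm_num at hs
  · nlinarith

lemma rayPoint_mem_arcCap (h : IsProfile a b N M) {D κ : ℝ} (hκ : κ * κ = 1) {r : ℝ}
    (hr : r ∈ Icc a b) :
    rayPoint D κ r (N r)⁻¹ ∈ arcCap D κ a b N M := by
  have hp := h.pos r hr
  constructor
  · rw [secantFun_rayPoint hκ, inv_mul_eq_div, one_le_div hp]
    exact h.le_secant hr
  · intro ρ hρ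
    rw [tangentFun_rayPoint hκ, inv_mul_eq_div, div_le_one hp]
    exact h.tangent_le hρ hr

lemma arcCap_subset_sector (h : IsProfile a b N M) {D κ : ℝ} :
    arcCap D κ a b N M ⊆ sector D κ a b := fun _ hx =>
  h.mem_sector hx.1 (hx.2 a h.a_mem) (hx.2 b h.b_mem)

lemma exists_rayPoint_of_mem_arcCap (h : IsProfile a b N M) {D κ : ℝ} (hκ : κ * κ = 1) {x : ℝ × ℝ}
    (hx : x ∈ arcCap D κ a b N M) :
    ∃ r ∈ Icc a b, ∃ z > 0, x = rayPoint D κ r z ∧ z * N r ≤ 1 := by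
  obtain ⟨r, hr, z, hz, rfl⟩ := exists_rayPoint_of_mem_sector hκ (h.arcCap_subset_sector hx)
  refine ⟨r, hr, z, hz, rfl, ?_⟩
  have := hx.2 r hr
  rw [tangentFun_rayPoint hκ] at this
  simpa using this

/-- A point on the chord is a convex combination of its endpoints. -/
lemma mem_of_secant_eq_one (h : IsProfile a b N M) {D κ : ℝ} (hκ : κ * κ = 1) {S : Set (ℝ × ℝ)}
    (hS : Convex ℝ S)
    (hSa : rayPoint D κ a (N a)⁻¹ ∈ S) (hSb : rayPoint D κ b (N b)⁻¹ ∈ S) {x : ℝ × ℝ}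
    (hs : secantFun D κ a b N x = 1)
    (ha : tangentFun D κ N M a x ≤ 1) (hb : tangentFun D κ N M b x ≤ 1) : x ∈ S := by
  obtain ⟨r, hr, z, hz, rfl⟩ := exists_rayPoint_of_mem_sector hκ (h.mem_sector hs.ge ha hb)
  rw [secantFun_rayPoint hκ] at hs
  have hd := sub_pos.2 h.lt
  have hpa := h.pos a h.a_mem
  have hpb := h.pos b h.b_mem
  have hsum : z * N a * (b - r) / (b - a) + z * N b * (r - a) / (b - a) = 1 := by
    rw [← add_div, div_eq_one_iff_eq hd.ne']
    linear_combination (b - a) * hs - z * (r - a) * h.slope_mul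
  have := hS hSa hSb (a := z * N a * (b - r) / (b - a)) (b := z * N b * (r - a) / (b - a))
    (div_nonneg (mul_nonneg (mul_pos hz hpa).le (sub_nonneg.2 hr.2)) hd.le)
    (div_nonneg (mul_nonneg (mul_pos hz hpb).le (sub_nonneg.2 hr.1)) hd.le) hsum
  convert this using 1
  have hd' := hd.ne'
  ext
  · simp only [rayPoint, Prod.fst_add, Prod.smul_fst, smul_eq_mul]
    field_simp
    ring
  · simp only [rayPoint, Prod.snd_add, Prod.smul_snd, smul_eq_mul]
    have : D = (z * N a * (b - r) / (b - a) + z * N b * (r - a) / (b - a)) * D := by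
      rw [hsum, one_mul]
    conv_lhs => rw [this]
    field_simp
    ring

end IsProfile

/-- A domain together with a boundary arc, of profile agreeing to first order at `a` and `b` with
the convex profile `N`. -/
structure IsReplaceable (K : Set (ℝ × ℝ)) (D κ a b : ℝ) (N M : ℝ → ℝ) : Prop where
  cscd : IsCSCD K
  prof : IsProfile a b N M
  sq : κ * κ = 1
  apex : ((0, D) : ℝ × ℝ) ∈ interior K
  tan_left : ∀ x ∈ K, tangentFun D κ N M a x ≤ 1
  tan_right : ∀ x ∈ K, tangentFun D κ N M b x ≤ 1
  left_mem : rayPoint D κ a (N a)⁻¹ ∈ K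
  right_mem : rayPoint D κ b (N b)⁻¹ ∈ K

lemma tangentFun_neg (D κ : ℝ) (N M : ℝ → ℝ) (ρ : ℝ) (x : ℝ × ℝ) :
    tangentFun D κ N M ρ (-x) = -tangentFun D κ N M ρ x + M ρ * (κ * (-(2 * D))) := by
  simp only [tangentFun, Prod.fst_neg, Prod.snd_neg]
  ring

lemma secantFun_neg (D κ a b : ℝ) (N : ℝ → ℝ) (x : ℝ × ℝ) :
    secantFun D κ a b N (-x) =
      -secantFun D κ a b N x + (N b - N a) / (b - a) * (κ * (-(2 * D))) := by
  simp only [secantFun, Prod.fst_neg, Prod.snd_neg]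
  ring

lemma IsProfile.isBounded_arcCap {a b : ℝ} {N M : ℝ → ℝ} (h : IsProfile a b N M) {D κ : ℝ}
    (hκ : κ * κ = 1) : Bornology.IsBounded (arcCap D κ a b N M) := by
  set c := min (N a) (N a + M a * (b - a)) with hc
  have hc0 : 0 < c := lt_min (h.pos a h.a_mem) h.left
  have hd := sub_pos.2 h.lt
  have hT : ∀ r ∈ Icc a b, c ≤ N a + M a * (r - a) := by
    intro r hr
    have e : (b - a) * (N a + M a * (r - a)) =
        (r - a) * (N a + M a * (b - a)) + (b - r) * N a := by ring
    have h1 := mul_le_mul_of_nonneg_left (min_le_right (N a) (N a + M a * (b - a)))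
      (sub_nonneg.2 hr.1)
    have h2 := mul_le_mul_of_nonneg_left (min_le_left (N a) (N a + M a * (b - a)))
      (sub_nonneg.2 hr.2)
    rw [← hc] at h1 h2
    have h3 : (b - a) * c ≤ (b - a) * (N a + M a * (r - a)) := by rw [e]; linarith
    exact le_of_mul_le_mul_left h3 hd
  have hκ1 : |κ| = 1 := by
    rw [← abs_mul_abs_self] at hκ
    nlinarith [abs_nonneg κ]
  set R := 1 / c with hR
  set S := |D| + R * max |a| |b| with hS
  refine (Metric.isBounded_Icc ((-R, -S) : ℝ × ℝ) (R, S)).subset ?_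
  intro x hx
  obtain ⟨r, hr, z, hz, rfl⟩ := exists_rayPoint_of_mem_sector hκ (h.arcCap_subset_sector hx)
  have hta := hx.2 a h.a_mem
  rw [tangentFun_rayPoint hκ] at hta
  have hzR : z ≤ R := by
    rw [hR, le_div_iff₀ hc0]
    exact (mul_le_mul_of_nonneg_left (hT r hr) hz.le).trans hta
  have h1 : |κ * z| ≤ R := by rw [abs_mul, hκ1, one_mul, abs_of_pos hz]; exact hzR
  have h2 : |D + κ * (z * r)| ≤ S := by
    refine (abs_add_le _ _).trans ?_
    rw [abs_mul, hκ1, one_mul, abs_mul, abs_of_pos hz]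
    have : |r| ≤ max |a| |b| := abs_le_max_abs_abs hr.1 hr.2
    exact add_le_add le_rfl (mul_le_mul hzR this (abs_nonneg _) (by positivity))
  exact ⟨⟨(abs_le.1 h1).1, (abs_le.1 h2).1⟩, ⟨(abs_le.1 h1).2, (abs_le.1 h2).2⟩⟩

lemma mem_interior_replaceArc {K : Set (ℝ × ℝ)} {D κ a b : ℝ} {N M : ℝ → ℝ} {x : ℝ × ℝ}
    (hx : x ∈ interior K)
    (h1 : secantFun D κ a b N x < 1) (h2 : secantFun D κ a b N (-x) < 1) :
    x ∈ interior (replaceArc K D κ a b N M) := by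
  rw [mem_interior]
  refine ⟨interior K ∩ {y | secantFun D κ a b N y < 1 ∧ secantFun D κ a b N (-y) < 1},
    fun y hy => Or.inl (Or.inl ⟨interior_subset hy.1, hy.2.1.le, hy.2.2.le⟩), ?_, hx, h1, h2⟩
  exact isOpen_interior.inter ((isOpen_lt (continuous_secantFun D κ a b N) continuous_const).inter
    (isOpen_lt ((continuous_secantFun D κ a b N).comp continuous_neg) continuous_const))

namespace IsReplaceable

variable {K : Set (ℝ × ℝ)} {D κ a b : ℝ} {N M : ℝ → ℝ}

lemma tangent_apex_left (h : IsReplaceable K D κ a b N M) : M a * (κ * (-(2 * D))) ≤ 1 := by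
  have := h.tan_left _ (h.cscd.neg_mem (interior_subset h.apex))
  rw [tangentFun_neg] at this
  simpa [tangentFun] using this

lemma tangent_apex_right (h : IsReplaceable K D κ a b N M) : M b * (κ * (-(2 * D))) ≤ 1 := by
  have := h.tan_right _ (h.cscd.neg_mem (interior_subset h.apex))
  rw [tangentFun_neg] at this
  simpa [tangentFun] using this

lemma secant_apex (h : IsReplaceable K D κ a b N M) :
    (N b - N a) / (b - a) * (κ * (-(2 * D))) < 1 := by
  have h1 := h.tangent_apex_left
  have h2 := h.tangent_apex_right
  have h3 := h.prof.left_lt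
  have h4 := h.prof.lt_right
  rcases lt_trichotomy (κ * (-(2 * D))) 0 with hc | hc | hc
  · nlinarith
  · rw [hc]; norm_num
  · nlinarith

lemma secant_neg_of_mem_cap (h : IsReplaceable K D κ a b N M) {x : ℝ × ℝ}
    (hx : x ∈ arcCap D κ a b N M) :
    secantFun D κ a b N (-x) < 1 := by
  have h1 := h.secant_apex
  have h2 := hx.1
  rw [secantFun_neg]
  linarith

lemma tangent_neg_of_mem_cap (h : IsReplaceable K D κ a b N M) {x : ℝ × ℝ}
    (hx : x ∈ arcCap D κ a b N M) :
    tangentFun D κ N M a (-x) ≤ 1 ∧ tangentFun D κ N M b (-x) ≤ 1 := by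
  obtain ⟨r, hr, z, hz, rfl, -⟩ := h.prof.exists_rayPoint_of_mem_arcCap h.sq hx
  rw [tangentFun_neg, tangentFun_neg, tangentFun_rayPoint h.sq, tangentFun_rayPoint h.sq]
  have h1 := h.tangent_apex_left
  have h2 := h.tangent_apex_right
  have h3 := mul_nonneg hz.le (h.prof.left_nonneg hr)
  have h4 := mul_nonneg hz.le (h.prof.right_nonneg hr)
  exact ⟨by linarith, by linarith⟩

lemma mem_of_secant (h : IsReplaceable K D κ a b N M) {x : ℝ × ℝ} (ha : tangentFun D κ N M a x ≤ 1)
    (hb : tangentFun D κ N M b x ≤ 1) (hs : secantFun D κ a b N x = 1) :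
    x ∈ K ∧ x ∈ arcCap D κ a b N M :=
  ⟨h.prof.mem_of_secant_eq_one h.sq h.cscd.1 h.left_mem h.right_mem hs ha hb,
    h.prof.mem_of_secant_eq_one h.sq (convex_arcCap ..)
      (h.prof.rayPoint_mem_arcCap h.sq h.prof.a_mem)
      (h.prof.rayPoint_mem_arcCap h.sq h.prof.b_mem) hs ha hb⟩

lemma convex_replaceArc (h : IsReplaceable K D κ a b N M) :
    Convex ℝ (replaceArc K D κ a b N M) := by
  have hH : Convex ℝ {x | tangentFun D κ N M a x ≤ 1 ∧ tangentFun D κ N M b x ≤ 1} :=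
    (convex_tangentFun_le D κ N M a).inter (convex_tangentFun_le D κ N M b)
  have hK1 : Convex ℝ ({x | x ∈ K ∧ secantFun D κ a b N x ≤ 1} ∪ arcCap D κ a b N M) := by
    refine Convex.union_of_cut h.cscd.1 (convex_arcCap ..) hH
      (fun x y s t hst => secantFun_combo D κ a b N x y hst) (fun x hx => hx.1)
      (fun x hx => ⟨h.tan_left x hx, h.tan_right x hx⟩)
      (fun x hx => ⟨hx.2 a h.prof.a_mem, hx.2 b h.prof.b_mem⟩)
      (fun x hx hs => h.mem_of_secant hx.1 hx.2 hs)
  have hneg : ∀ S : Set (ℝ × ℝ), Convex ℝ S → Convex ℝ {x | -x ∈ S} := fun S hS =>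
    hS.is_linear_preimage (f := fun x => -x) (IsLinearMap.isLinearMap_neg)
  have := Convex.union_of_cut hK1 (hneg _ (convex_arcCap D κ a b N M)) (hneg _ hH)
    (L := fun x => secantFun D κ a b N (-x)) (fun x y s t hst => by
      rw [← secantFun_combo _ _ _ _ _ _ _ hst]; congr 1; module)
    (fun x hx => hx.1) ?_ (fun x hx => ⟨hx.2 a h.prof.a_mem, hx.2 b h.prof.b_mem⟩) ?_
  · convert this using 1
    ext x
    simp only [replaceArc, mem_union, mem_ofPred_eq]
    constructor
    · rintro ((hx | hx) | hx)
      · exact Or.inl ⟨Or.inl ⟨hx.1, hx.2.1⟩, hx.2.2⟩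
      · exact Or.inl ⟨Or.inr hx, (h.secant_neg_of_mem_cap hx).le⟩
      · exact Or.inr hx
    · rintro (⟨hx | hx, hx'⟩ | hx)
      · exact Or.inl (Or.inl ⟨hx.1, hx.2, hx'⟩)
      · exact Or.inl (Or.inr hx)
      · exact Or.inr hx
  · rintro x (hx | hx)
    · exact ⟨h.tan_left _ (h.cscd.neg_mem hx.1), h.tan_right _ (h.cscd.neg_mem hx.1)⟩
    · exact h.tangent_neg_of_mem_cap hx
  · intro x hx hs
    obtain ⟨h1, h2⟩ := h.mem_of_secant hx.1 hx.2 hs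
    refine ⟨Or.inl ⟨h.cscd.neg_mem_iff.1 h1, ?_⟩, h2⟩
    simpa using (h.secant_neg_of_mem_cap h2).le

lemma apex_mem_interior (h : IsReplaceable K D κ a b N M) :
    ((0, D) : ℝ × ℝ) ∈ interior (replaceArc K D κ a b N M) := by
  have h0 : secantFun D κ a b N (0, D) = 0 := by simp [secantFun]
  refine mem_interior_replaceArc h.apex (by rw [h0]; norm_num) ?_
  rw [secantFun_neg, h0, neg_zero, zero_add]
  exact h.secant_apex

lemma neg_mem_replaceArc (h : IsReplaceable K D κ a b N M) {x : ℝ × ℝ}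
    (hx : x ∈ replaceArc K D κ a b N M) :
    -x ∈ replaceArc K D κ a b N M := by
  rcases hx with (hx | hx) | hx
  · exact Or.inl (Or.inl ⟨h.cscd.neg_mem hx.1, hx.2.2, by simpa using hx.2.1⟩)
  · exact Or.inr (by simpa using hx)
  · exact Or.inl (Or.inr hx)

lemma isCSCD_replaceArc (h : IsReplaceable K D κ a b N M) : IsCSCD (replaceArc K D κ a b N M) := by
  refine ⟨h.convex_replaceArc, ?_, ⟨_, h.apex_mem_interior⟩, ?_⟩
  · refine Metric.isCompact_of_isClosed_isBounded ?_ ?_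
    · refine ((h.cscd.isClosed.inter ?_).union (isClosed_arcCap ..)).union
        ((isClosed_arcCap ..).preimage continuous_neg)
      exact (isClosed_le (continuous_secantFun D κ a b N) continuous_const).inter
        (isClosed_le ((continuous_secantFun D κ a b N).comp continuous_neg) continuous_const)
    · refine Bornology.IsBounded.union (Bornology.IsBounded.union
        (h.cscd.2.1.isBounded.subset fun x hx => hx.1) (h.prof.isBounded_arcCap h.sq)) ?_
      have := (h.prof.isBounded_arcCap (D := D) h.sq).neg
      exact this
  · ext x
    rw [Set.mem_neg]
    exact ⟨h.neg_mem_replaceArc, fun hx => by simpa using h.neg_mem_replaceArc hx⟩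

lemma rayPoint_mem_replaceArc (h : IsReplaceable K D κ a b N M) {r : ℝ} (hr : r ∈ Icc a b) :
    rayPoint D κ r (N r)⁻¹ ∈ replaceArc K D κ a b N M :=
  Or.inl (Or.inr (h.prof.rayPoint_mem_arcCap h.sq hr))

lemma mem_replaceArc_of_notMem_sector (h : IsReplaceable K D κ a b N M) {x : ℝ × ℝ} (hx : x ∈ K)
    (h1 : x ∉ sector D κ a b)
    (h2 : -x ∉ sector D κ a b) : x ∈ replaceArc K D κ a b N M := by
  refine Or.inl (Or.inl ⟨hx, ?_, ?_⟩)
  · by_contra! hc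
    exact h1 (h.prof.mem_sector hc.le (h.tan_left x hx) (h.tan_right x hx))
  · by_contra! hc
    exact h2 (h.prof.mem_sector hc.le (h.tan_left _ (h.cscd.neg_mem hx))
      (h.tan_right _ (h.cscd.neg_mem hx)))

lemma eq_rayPoint_of_mem_cap (h : IsReplaceable K D κ a b N M) {x : ℝ × ℝ}
    (hx : x ∈ arcCap D κ a b N M)
    (hxi : x ∉ interior (replaceArc K D κ a b N M)) :
    ∃ r ∈ Icc a b, x = rayPoint D κ r (N r)⁻¹ := by
  obtain ⟨r, hr, z, hz, rfl, hzN⟩ := h.prof.exists_rayPoint_of_mem_arcCap h.sq hx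
  refine ⟨r, hr, ?_⟩
  have hp := h.prof.pos r hr
  rcases eq_or_lt_of_le hzN with he | hlt
  · rw [eq_inv_of_mul_eq_one_left he]
  · exfalso
    apply hxi
    refine h.convex_replaceArc.openSegment_interior_self_subset_interior h.apex_mem_interior
      (h.rayPoint_mem_replaceArc hr) ⟨1 - z * N r, z * N r, by linarith, by positivity,
        by ring, ?_⟩
    ext
    · simp only [rayPoint, Prod.fst_add, Prod.smul_fst, smul_eq_mul]
      field_simp
      ring
    · simp only [rayPoint, Prod.snd_add, Prod.smul_snd, smul_eq_mul]
      field_simp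
      ring

lemma frontier_replaceArc (h : IsReplaceable K D κ a b N M) {x : ℝ × ℝ}
    (hx : x ∈ frontier (replaceArc K D κ a b N M)) :
    x ∈ frontier K ∨ ∃ r ∈ Icc a b, x = rayPoint D κ r (N r)⁻¹ ∨ -x = rayPoint D κ r (N r)⁻¹ := by
  have hK2 := h.isCSCD_replaceArc
  obtain ⟨hxm, hxi⟩ := hK2.frontier_iff.1 hx
  have hnxi := (hK2.frontier_iff.1 (hK2.neg_frontier hx)).2
  have hcap : x ∈ arcCap D κ a b N M → _ := fun hc => h.eq_rayPoint_of_mem_cap hc hxi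
  have hncap : -x ∈ arcCap D κ a b N M → _ := fun hc => h.eq_rayPoint_of_mem_cap hc hnxi
  rcases hxm with (hxm | hxm) | hxm
  · by_cases hxK : x ∈ interior K
    · obtain ⟨h0, h1, h2⟩ := hxm
      right
      rcases eq_or_lt_of_le h1 with h1 | h1
      · obtain ⟨r, hr, e⟩ := hcap (h.mem_of_secant (h.tan_left x h0) (h.tan_right x h0) h1).2
        exact ⟨r, hr, Or.inl e⟩
      rcases eq_or_lt_of_le h2 with h2 | h2
      · have h0' := h.cscd.neg_mem h0
        obtain ⟨r, hr, e⟩ := hncap (h.mem_of_secant (h.tan_left _ h0') (h.tan_right _ h0') h2).2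
        exact ⟨r, hr, Or.inr e⟩
      exact absurd (mem_interior_replaceArc hxK h1 h2) hxi
    · exact Or.inl (h.cscd.frontier_iff.2 ⟨hxm.1, hxK⟩)
  · obtain ⟨r, hr, e⟩ := hcap hxm
    exact Or.inr ⟨r, hr, Or.inl e⟩
  · obtain ⟨r, hr, e⟩ := hncap hxm
    exact Or.inr ⟨r, hr, Or.inr e⟩

end IsReplaceable

/-! ### Convex profiles and their perturbations -/

lemma tangent_lt_of_deriv2_pos {a b : ℝ} {f f' f'' : ℝ → ℝ}
    (h1 : ∀ x ∈ Icc a b, HasDerivAt f (f' x) x) (h2 : ∀ x ∈ Icc a b, HasDerivAt f' (f'' x) x)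
    (h3 : ∀ x ∈ Icc a b, 0 < f'' x) {ρ r : ℝ} (hρ : ρ ∈ Icc a b) (hr : r ∈ Icc a b)
    (hne : ρ ≠ r) : f ρ + f' ρ * (r - ρ) < f r := by
  have hmono : StrictMonoOn f' (Icc a b) :=
    strictMonoOn_of_deriv_pos (convex_Icc a b)
      (fun x hx => (h2 x hx).continuousAt.continuousWithinAt) fun x hx => by
        have hx' := interior_subset hx
        rw [(h2 x hx').deriv]
        exact h3 x hx'
  rcases lt_or_gt_of_ne hne with hlt | hlt
  · have hsub : Icc ρ r ⊆ Icc a b := Icc_subset_Icc hρ.1 hr.2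
    obtain ⟨c, hc, he⟩ := exists_hasDerivAt_eq_slope f f' hlt
      (fun x hx => (h1 x (hsub hx)).continuousAt.continuousWithinAt)
      (fun x hx => h1 x (hsub (Ioo_subset_Icc_self hx)))
    have h4 := hmono hρ (hsub (Ioo_subset_Icc_self hc)) hc.1
    rw [he, lt_div_iff₀ (sub_pos.2 hlt)] at h4
    linarith
  · have hsub : Icc r ρ ⊆ Icc a b := Icc_subset_Icc hr.1 hρ.2
    obtain ⟨c, hc, he⟩ := exists_hasDerivAt_eq_slope f f' hlt
      (fun x hx => (h1 x (hsub hx)).continuousAt.continuousWithinAt)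
      (fun x hx => h1 x (hsub (Ioo_subset_Icc_self hx)))
    have h4 := hmono (hsub (Ioo_subset_Icc_self hc)) hρ hc.2
    rw [he, div_lt_iff₀ (sub_pos.2 hlt)] at h4
    linarith

lemma hasDerivAt_inv_deriv {z z' : ℝ → ℝ} {z'' x : ℝ} (h1 : HasDerivAt z (z' x) x)
    (h2 : HasDerivAt z' z'' x) (h0 : z x ≠ 0) :
    HasDerivAt (fun r => -z' r / z r ^ 2) ((2 * z' x ^ 2 - z x * z'') / z x ^ 3) x := by
  refine (h2.fun_neg.fun_div (h1.fun_pow 2) (pow_ne_zero 2 h0)).congr_deriv ?_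
  field_simp
  ring

lemma isProfile_inv {a b : ℝ} {z z' z'' : ℝ → ℝ} (hab : a < b)
    (h1 : ∀ x ∈ Icc a b, HasDerivAt z (z' x) x) (h2 : ∀ x ∈ Icc a b, HasDerivAt z' (z'' x) x)
    (h0 : ∀ x ∈ Icc a b, 0 < z x) (h3 : ∀ x ∈ Icc a b, 0 < 2 * z' x ^ 2 - z x * z'' x)
    (hl : 0 < z a - z' a * (b - a)) (hr : 0 < z b - z' b * (a - b)) :
    IsProfile a b (fun r => (z r)⁻¹) (fun r => -z' r / z r ^ 2) := by
  have e : ∀ u v t : ℝ, 0 < u → u⁻¹ + -v / u ^ 2 * t = (u - v * t) / u ^ 2 := by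
    intro u v t hu
    field_simp
    ring
  refine ⟨hab, fun r hr => inv_pos.2 (h0 r hr), fun ρ hρ r hr hne => ?_, ?_, ?_⟩
  · exact tangent_lt_of_deriv2_pos (f := fun r => (z r)⁻¹) (f' := fun r => -z' r / z r ^ 2)
      (fun x hx => (h1 x hx).fun_inv (h0 x hx).ne')
      (fun x hx => hasDerivAt_inv_deriv (h1 x hx) (h2 x hx) (h0 x hx).ne')
      (fun x hx => div_pos (h3 x hx) (pow_pos (h0 x hx) 3)) hρ hr hne
  · have := h0 a ⟨le_rfl, hab.le⟩
    rw [e _ _ _ this]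
    positivity
  · have := h0 b ⟨hab.le, le_rfl⟩
    rw [e _ _ _ this]
    positivity

/-- The supporting line at a differentiable boundary point is the tangent. -/
lemma tangentFun_le_one {K : Set (ℝ × ℝ)} (hK : IsCSCD K) {D κ : ℝ} (hκ : κ * κ = 1)
    (hapex : ((0, D) : ℝ × ℝ) ∈ interior K) {z : ℝ → ℝ} {z' ρ : ℝ} (hz : 0 < z ρ)
    (hd : HasDerivAt z z' ρ) (hρ : rayPoint D κ ρ (z ρ) ∈ frontier K)
    (hnear : ∀ᶠ r in 𝓝 ρ, rayPoint D κ r (z r) ∈ K) {N M : ℝ → ℝ} (hN : N ρ = (z ρ)⁻¹)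
    (hM : M ρ = -z' / z ρ ^ 2) {x : ℝ × ℝ} (hx : x ∈ K) : tangentFun D κ N M ρ x ≤ 1 := by
  obtain ⟨α, β, hs, hle⟩ := exists_support hK.1 hK.2.2.1 (hK.frontier_iff.1 hρ).2
  have hs0 := hs _ hapex
  simp only [rayPoint] at hs0
  set A := κ * (α + β * ρ) with hA
  have hA0 : 0 < A := by
    by_contra! hc
    nlinarith
  have hmax : IsLocalMax (fun r => κ * (z r * (α + β * r))) ρ := by
    filter_upwards [hnear] with r hr
    have := hle _ hr
    simp only [rayPoint] at this
    linarith
  have hder : HasDerivAt (fun r => κ * (z r * (α + β * r)))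
      (κ * (z' * (α + β * ρ) + z ρ * (β * 1))) ρ :=
    (hd.mul (((hasDerivAt_id ρ).const_mul β).const_add α)).const_mul κ
  have h0 := hmax.hasDerivAt_eq_zero hder
  have hκ0 : κ ≠ 0 := by rintro rfl; norm_num at hκ
  have h1 : z' * (α + β * ρ) + z ρ * β = 0 := by
    have := (mul_eq_zero.1 h0).resolve_left hκ0
    linarith
  have hxle := hle x hx
  simp only [rayPoint] at hxle
  have key : tangentFun D κ N M ρ x * (z ρ * A) = α * x.1 + β * (x.2 - D) := by
    simp only [tangentFun, hN, hM, hA]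
    have hz' := hz.ne'
    field_simp
    linear_combination (z ρ * (α * x.1 + β * (x.2 - D))) * hκ -
      (κ ^ 2 * (x.2 - D - ρ * x.1)) * h1
  have hzA : 0 < z ρ * A := by positivity
  by_contra! hc
  have : z ρ * A < tangentFun D κ N M ρ x * (z ρ * A) := by nlinarith
  rw [key] at this
  have e : z ρ * A = κ * z ρ * (α + β * ρ) := by rw [hA]; ring
  nlinarith

/-- A curved boundary arc is curved outwards. -/
lemma curvature_pos {K : Set (ℝ × ℝ)} (hK : IsCSCD K) {D κ : ℝ} (hκ : κ * κ = 1)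
    (hapex : ((0, D) : ℝ × ℝ) ∈ interior K) {z z' z'' : ℝ → ℝ} {ρ : ℝ} (hz : 0 < z ρ)
    (h1 : ∀ᶠ r in 𝓝 ρ, HasDerivAt z (z' r) r) (h2 : ∀ᶠ r in 𝓝 ρ, HasDerivAt z' (z'' r) r)
    (h3 : ContinuousAt z'' ρ) (hfr : ∀ᶠ r in 𝓝 ρ, rayPoint D κ r (z r) ∈ frontier K)
    (hne : 2 * z' ρ ^ 2 - z ρ * z'' ρ ≠ 0) : 0 < 2 * z' ρ ^ 2 - z ρ * z'' ρ := by
  by_contra! hle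
  have hlt := lt_of_le_of_ne hle hne
  have hc0 : ContinuousAt z ρ := h1.self_of_nhds.continuousAt
  have hc1 : ContinuousAt z' ρ := h2.self_of_nhds.continuousAt
  have hG : ∀ᶠ r in 𝓝 ρ, 2 * z' r ^ 2 - z r * z'' r < 0 :=
    (((hc1.pow 2).const_mul 2).sub (hc0.mul h3)).eventually_lt_const hlt
  have hpos : ∀ᶠ r in 𝓝 ρ, 0 < z r := hc0.eventually_const_lt hz
  obtain ⟨ε, hε, hball⟩ := Metric.eventually_nhds_iff_ball.1
    (h1.and (h2.and (hG.and (hpos.and hfr))))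
  have hsub : ∀ x ∈ Icc ρ (ρ + ε / 2), x ∈ Metric.ball ρ ε := by
    intro x hx
    rw [Metric.mem_ball, Real.dist_eq, abs_lt]
    constructor <;> linarith [hx.1, hx.2]
  have hmem : ρ ∈ Icc ρ (ρ + ε / 2) := ⟨le_rfl, by linarith⟩
  have hmem' : ρ + ε / 2 ∈ Icc ρ (ρ + ε / 2) := ⟨by linarith, le_rfl⟩
  have key := tangent_lt_of_deriv2_pos (f := fun r => -(z r)⁻¹)
    (f' := fun r => -(-z' r / z r ^ 2))
    (f'' := fun r => -((2 * z' r ^ 2 - z r * z'' r) / z r ^ 3))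
    (fun x hx => by
      have hb := hball x (hsub x hx)
      exact (hb.1.fun_inv hb.2.2.2.1.ne').fun_neg)
    (fun x hx => by
      have hb := hball x (hsub x hx)
      exact (hasDerivAt_inv_deriv hb.1 hb.2.1 hb.2.2.2.1.ne').fun_neg)
    (fun x hx => by
      have hb := hball x (hsub x hx)
      exact neg_pos.2 (div_neg_of_neg_of_pos hb.2.2.1 (pow_pos hb.2.2.2.1 3)))
    hmem hmem' (by linarith)
  have hb := hball _ (hsub _ hmem')
  have ht := tangentFun_le_one hK hκ hapex hz h1.self_of_nhds hfr.self_of_nhds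
    (hfr.mono fun r hr => (hK.frontier_iff.1 hr).1) (N := fun r => (z r)⁻¹)
    (M := fun r => -z' r / z r ^ 2) rfl rfl (hK.frontier_iff.1 hb.2.2.2.2).1
  rw [tangentFun_rayPoint hκ] at ht
  have hzp := hb.2.2.2.1
  have h4 : (z ρ)⁻¹ + -z' ρ / z ρ ^ 2 * (ρ + ε / 2 - ρ) ≤ (z (ρ + ε / 2))⁻¹ := by
    rw [← one_div (z (ρ + ε / 2)), le_div_iff₀ hzp]
    linarith
  linarith

/-- `Y` is an inward perturbation of `y` on `[a, b]`, to first order equal at the ends. -/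
structure IsPerturbation (y y1 : ℝ → ℝ) (a b w : ℝ) (Y Y1 : ℝ → ℝ) : Prop where
  profL : IsProfile a b (fun r => (Y r)⁻¹) (fun r => -Y1 r / Y r ^ 2)
  profR : IsProfile a b (fun r => (1 - Y r)⁻¹) (fun r => -(-Y1 r) / (1 - Y r) ^ 2)
  half_lt : 1 / 2 < w
  le_Y : ∀ r ∈ Icc a b, w ≤ Y r
  Y_le : ∀ r ∈ Icc a b, Y r ≤ y r
  lt_one : ∀ r ∈ Icc a b, y r < 1
  Y_lt : ∀ r ∈ Ioo a b, Y r < y r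
  left : Y a = y a
  left1 : Y1 a = y1 a
  right : Y b = y b
  right1 : Y1 b = y1 b

lemma exists_perturbation {y y1 y2 : ℝ → ℝ} {ρ : ℝ}
    (h1 : ∀ᶠ r in 𝓝 ρ, HasDerivAt y (y1 r) r) (h2 : ∀ᶠ r in 𝓝 ρ, HasDerivAt y1 (y2 r) r)
    (h3 : ContinuousAt y2 ρ) (hl : 1 / 2 < y ρ) (hr : y ρ < 1)
    (hL : 0 < 2 * y1 ρ ^ 2 - y ρ * y2 ρ) (hR : 0 < 2 * y1 ρ ^ 2 + (1 - y ρ) * y2 ρ)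
    {S : Set ℝ} (hS : S ∈ 𝓝 ρ) {δ : ℝ} (hδ : 0 < δ) :
    ∃ a b w : ℝ, ∃ Y Y1 : ℝ → ℝ, b - a < δ ∧ Icc a b ⊆ S ∧ IsPerturbation y y1 a b w Y Y1 := by
  have hc0 : ContinuousAt y ρ := h1.self_of_nhds.continuousAt
  have hc1 : ContinuousAt y1 ρ := h2.self_of_nhds.continuousAt
  obtain ⟨c, hc, hcl, hcr⟩ : ∃ c > 0, 1 / 2 + c < y ρ ∧ y ρ < 1 - c := by
    refine ⟨min ((y ρ - 1 / 2) / 2) ((1 - y ρ) / 2), lt_min (by linarith) (by linarith), ?_, ?_⟩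
    · have := min_le_left ((y ρ - 1 / 2) / 2) ((1 - y ρ) / 2); linarith
    · have := min_le_right ((y ρ - 1 / 2) / 2) ((1 - y ρ) / 2); linarith
  set B := |y1 ρ| + 1 with hB
  have hB0 : 0 < B := by positivity
  let U : Set (ℝ × ℝ × ℝ) := {p | 1 / 2 + c < p.1 ∧ p.1 < 1 - c ∧
    0 < 2 * p.2.1 ^ 2 - p.1 * p.2.2 ∧ 0 < 2 * p.2.1 ^ 2 + (1 - p.1) * p.2.2 ∧ |p.2.1| < B}
  have hU : IsOpen U := by
    have o1 : IsOpen {p : ℝ × ℝ × ℝ | 1 / 2 + c < p.1} :=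
      isOpen_lt continuous_const continuous_fst
    have o2 : IsOpen {p : ℝ × ℝ × ℝ | p.1 < 1 - c} := isOpen_lt continuous_fst continuous_const
    have o3 : IsOpen {p : ℝ × ℝ × ℝ | 0 < 2 * p.2.1 ^ 2 - p.1 * p.2.2} :=
      isOpen_lt continuous_const (by fun_prop)
    have o4 : IsOpen {p : ℝ × ℝ × ℝ | 0 < 2 * p.2.1 ^ 2 + (1 - p.1) * p.2.2} :=
      isOpen_lt continuous_const (by fun_prop)
    have o5 : IsOpen {p : ℝ × ℝ × ℝ | |p.2.1| < B} :=
      isOpen_lt (by fun_prop) continuous_const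
    exact o1.inter (o2.inter (o3.inter (o4.inter o5)))
  have hpU : (y ρ, y1 ρ, y2 ρ) ∈ U := ⟨hcl, hcr, hL, hR, by rw [hB]; simp⟩
  obtain ⟨η, hη, hball⟩ := Metric.isOpen_iff.1 hU _ hpU
  have hUof : ∀ u0 u1 u2 : ℝ, |u0 - y ρ| < η → |u1 - y1 ρ| < η → |u2 - y2 ρ| < η →
      (u0, u1, u2) ∈ U := by
    intro u0 u1 u2 g0 g1 g2
    apply hball
    rw [Metric.mem_ball, Prod.dist_eq, Prod.dist_eq, Real.dist_eq, Real.dist_eq, Real.dist_eq]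
    exact max_lt g0 (max_lt g1 g2)
  have hcont : ∀ (f : ℝ → ℝ), ContinuousAt f ρ → ∀ᶠ r in 𝓝 ρ, |f r - f ρ| < η / 2 := by
    intro f hf
    have := Metric.continuousAt_iff'.1 hf (η / 2) (by positivity)
    simpa only [Real.dist_eq] using this
  obtain ⟨d, hd, hnear⟩ := Metric.eventually_nhds_iff_ball.1 ((hcont y hc0).and
    ((hcont y1 hc1).and ((hcont y2 h3).and (h1.and (h2.and hS)))))
  obtain ⟨h, hh0, hhd, hhδ, hh1, hhB⟩ : ∃ h > 0, h < d ∧ 2 * h < δ ∧ 2 * h ≤ 1 ∧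
      2 * h * B ≤ c := by
    refine ⟨min (min (d / 2) (δ / 4)) (min (1 / 2) (c / (2 * B))), by positivity, ?_, ?_, ?_, ?_⟩
    · have := (min_le_left (min (d / 2) (δ / 4)) (min (1 / 2) (c / (2 * B)))).trans
        (min_le_left _ _)
      linarith
    · have := (min_le_left (min (d / 2) (δ / 4)) (min (1 / 2) (c / (2 * B)))).trans
        (min_le_right _ _)
      linarith
    · have := (min_le_right (min (d / 2) (δ / 4)) (min (1 / 2) (c / (2 * B)))).trans
        (min_le_left _ _)
      linarith
    · have := (min_le_right (min (d / 2) (δ / 4)) (min (1 / 2) (c / (2 * B)))).trans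
        (min_le_right _ _)
      rw [le_div_iff₀ (by positivity)] at this
      linarith
  set a := ρ - h with ha
  set b := ρ + h with hb
  set ε := η / 14 with hε
  have hε0 : 0 < ε := by positivity
  have hab : a < b := by linarith
  have hba : b - a = 2 * h := by rw [ha, hb]; ring
  have hsub : ∀ r ∈ Icc a b, r ∈ Metric.ball ρ d := by
    intro r hr
    rw [Metric.mem_ball, Real.dist_eq, abs_lt]
    constructor <;> linarith [hr.1, hr.2]
  let Y : ℝ → ℝ := fun r => y r - ε * ((r - a) * (b - r)) ^ 2
  let Y1 : ℝ → ℝ := fun r => y1 r - ε * (2 * ((r - a) * (b - r)) * (a + b - 2 * r))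
  let Y2 : ℝ → ℝ := fun r => y2 r - ε * (2 * (a + b - 2 * r) ^ 2 - 4 * ((r - a) * (b - r)))
  have hu : ∀ r ∈ Icc a b, 0 ≤ (r - a) * (b - r) ∧ (r - a) * (b - r) ≤ 1 ∧
      |a + b - 2 * r| ≤ 1 := by
    intro r hr
    have g1 := sub_nonneg.2 hr.1
    have g2 := sub_nonneg.2 hr.2
    refine ⟨mul_nonneg g1 g2, ?_, abs_le.2 ⟨by linarith, by linarith⟩⟩
    nlinarith
  have hYU : ∀ r ∈ Icc a b, (Y r, Y1 r, Y2 r) ∈ U := by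
    intro r hr
    obtain ⟨g0, g1, g2, -⟩ := hnear r (hsub r hr)
    obtain ⟨k0, k1, k2⟩ := hu r hr
    set u := (r - a) * (b - r) with hudef
    set v := a + b - 2 * r with hvdef
    have hv2 : v ^ 2 ≤ 1 := by rw [← sq_abs]; nlinarith [abs_nonneg v]
    have gen : ∀ p q e : ℝ, |p - q| < η / 2 → |e| ≤ 6 → |p - ε * e - q| < η := by
      intro p q e hpq he
      have e1 : p - ε * e - q = (p - q) - ε * e := by ring
      rw [e1]
      refine (abs_sub _ _).trans_lt ?_
      rw [abs_mul, abs_of_pos hε0]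
      nlinarith
    have f0 : |u ^ 2| ≤ 6 := by
      rw [abs_of_nonneg (sq_nonneg u)]
      exact (pow_le_one₀ k0 k1).trans (by norm_num)
    have f1 : |2 * u * v| ≤ 6 := by
      rw [abs_mul, abs_of_nonneg (mul_nonneg zero_le_two k0)]
      have := mul_le_one₀ k1 (abs_nonneg v) k2
      linarith
    have f2 : |2 * v ^ 2 - 4 * u| ≤ 6 := by
      rw [abs_le]
      constructor <;> linarith [sq_nonneg v]
    exact hUof _ _ _ (gen (y r) (y ρ) (u ^ 2) g0 f0) (gen (y1 r) (y1 ρ) (2 * u * v) g1 f1)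
      (gen (y2 r) (y2 ρ) (2 * v ^ 2 - 4 * u) g2 f2)
  have hyU : ∀ r ∈ Icc a b, (y r, y1 r, y2 r) ∈ U := by
    intro r hr
    obtain ⟨g0, g1, g2, -⟩ := hnear r (hsub r hr)
    exact hUof _ _ _ (by linarith) (by linarith) (by linarith)
  have hu1 : ∀ r, HasDerivAt (fun r => (r - a) * (b - r)) (a + b - 2 * r) r := by
    intro r
    exact (((hasDerivAt_id' r).sub_const a).fun_mul ((hasDerivAt_id' r).const_sub b)).congr_deriv
      (by ring)
  have hu2 : ∀ r, HasDerivAt (fun r => a + b - 2 * r) (-2) r := by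
    intro r
    exact (((hasDerivAt_id' r).const_mul 2).const_sub (a + b)).congr_deriv (by ring)
  have hY1 : ∀ r ∈ Icc a b, HasDerivAt Y (Y1 r) r := by
    intro r hr
    obtain ⟨-, -, -, g3, -⟩ := hnear r (hsub r hr)
    exact (g3.fun_sub (((hu1 r).fun_pow 2).const_mul ε)).congr_deriv (by simp only [Y1]; ring)
  have hY2 : ∀ r ∈ Icc a b, HasDerivAt Y1 (Y2 r) r := by
    intro r hr
    obtain ⟨-, -, -, -, g4, -⟩ := hnear r (hsub r hr)
    exact (g4.fun_sub ((((hu1 r).const_mul 2).fun_mul (hu2 r)).const_mul ε)).congr_deriv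
      (by simp only [Y2]; ring)
  have ham : a ∈ Icc a b := ⟨le_rfl, hab.le⟩
  have hbm : b ∈ Icc a b := ⟨hab.le, le_rfl⟩
  have hend : ∀ r ∈ Icc a b, |Y1 r * (b - a)| < c := by
    intro r hr
    have := (hYU r hr).2.2.2.2
    simp only at this
    have h2h : 0 < 2 * h := by linarith
    rw [abs_mul, hba, abs_of_pos h2h]
    nlinarith
  have hea := abs_lt.1 (hend a ham)
  have heb := abs_lt.1 (hend b hbm)
  refine ⟨a, b, 1 / 2 + c, Y, Y1, by linarith, fun r hr => (hnear r (hsub r hr)).2.2.2.2.2,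
    ?_, ?_, by linarith, fun r hr => (hYU r hr).1.le, ?_, ?_, ?_, ?_, ?_, ?_, ?_⟩
  · refine isProfile_inv hab hY1 hY2
      (fun r hr => by have := (hYU r hr).1; simp only at this; linarith)
      (fun r hr => (hYU r hr).2.2.1) ?_ ?_
    · have := (hYU a ham).1
      simp only at this
      linarith
    · have := (hYU b hbm).1
      simp only at this
      linarith
  · refine isProfile_inv (z := fun r => 1 - Y r) (z' := fun r => -Y1 r) (z'' := fun r => -Y2 r) hab
      (fun r hr => (hY1 r hr).const_sub 1) (fun r hr => (hY2 r hr).neg)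
      (fun r hr => by have := (hYU r hr).2.1; simp only at this; linarith)
      (fun r hr => ?_) ?_ ?_
    · have := (hYU r hr).2.2.2.1
      simp only at this
      linarith
    · have := (hYU a ham).2.1
      simp only at this
      linarith
    · have := (hYU b hbm).2.1
      simp only at this
      linarith
  · intro r hr
    have : 0 ≤ ε * ((r - a) * (b - r)) ^ 2 := by positivity
    simp only [Y]
    linarith
  · intro r hr
    have := (hyU r hr).2.1
    simp only at this
    linarith
  · intro r hr
    have g1 := sub_pos.2 hr.1
    have g2 := sub_pos.2 hr.2
    have : 0 < ε * ((r - a) * (b - r)) ^ 2 := by positivity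
    simp only [Y]
    linarith
  · simp [Y]
  · simp [Y1]
  · simp [Y]
  · simp [Y1]

/-! ### Transferring area between the two arcs -/

/-- The derivative of `x ↦ (x.1 + 1, x.2 + (x.2 - D) / x.1)`. -/
def transferDeriv (D : ℝ) (x : ℝ × ℝ) : ℝ × ℝ →L[ℝ] ℝ × ℝ :=
  (Matrix.toLin (.finTwoProd ℝ) (.finTwoProd ℝ)
    !![1, 0; -((x.2 - D) / x.1 ^ 2), 1 + x.1⁻¹]).toContinuousLinearMap

lemma hasFDerivAt_transfer (D : ℝ) {x : ℝ × ℝ} (hx : x.1 ≠ 0) :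
    HasFDerivAt (fun x : ℝ × ℝ => ((x.1 + 1, x.2 + (x.2 - D) * x.1⁻¹) : ℝ × ℝ))
      (transferDeriv D x) x := by
  unfold transferDeriv
  rw [Matrix.toLin_finTwoProd_toContinuousLinearMap]
  have h1 : HasFDerivAt (fun x : ℝ × ℝ => x.1 + 1) (ContinuousLinearMap.fst ℝ ℝ ℝ) x :=
    hasFDerivAt_fst.add_const 1
  have hi : HasFDerivAt (fun x : ℝ × ℝ => x.1⁻¹)
      ((-(x.1 ^ 2)⁻¹) • ContinuousLinearMap.fst ℝ ℝ ℝ) x :=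
    (hasDerivAt_inv hx).comp_hasFDerivAt x hasFDerivAt_fst
  have h2 : HasFDerivAt (fun x : ℝ × ℝ => x.2 + (x.2 - D) * x.1⁻¹)
      (ContinuousLinearMap.snd ℝ ℝ ℝ + ((x.2 - D) • ((-(x.1 ^ 2)⁻¹) •
        ContinuousLinearMap.fst ℝ ℝ ℝ) + x.1⁻¹ • ContinuousLinearMap.snd ℝ ℝ ℝ)) x :=
    hasFDerivAt_snd.fun_add ((hasFDerivAt_snd.sub_const D).fun_mul hi)
  refine (h1.prodMk h2).congr_fderiv ?_
  ext <;> simp [div_eq_mul_inv]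

lemma det_transferDeriv (D : ℝ) (x : ℝ × ℝ) : (transferDeriv D x).det = 1 + x.1⁻¹ := by
  unfold transferDeriv
  simp only [LinearMap.det_toContinuousLinearMap, LinearMap.det_toLin, Matrix.det_fin_two_of]
  ring

lemma volume_transfer_lt {D w : ℝ} (hw : 1 / 2 < w) {A : Set (ℝ × ℝ)} (hA : MeasurableSet A)
    (h1 : ∀ x ∈ A, -1 ≤ x.1 ∧ x.1 ≤ -w) (h0 : volume A ≠ 0) (hfin : volume A ≠ ⊤) :
    volume ((fun x : ℝ × ℝ => ((x.1 + 1, x.2 + (x.2 - D) * x.1⁻¹) : ℝ × ℝ)) '' A) <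
      volume A := by
  have hw0 : 0 < w := by linarith
  have hne : ∀ x ∈ A, x.1 ≠ 0 := fun x hx h => by have := (h1 x hx).2; linarith
  have hc : w⁻¹ - 1 < 1 := by
    have : w⁻¹ < 2 := by rw [inv_lt_comm₀ hw0 two_pos]; linarith
    linarith
  calc _ ≤ ∫⁻ x in A, ENNReal.ofReal |(transferDeriv D x).det| :=
        addHaar_image_le_lintegral_abs_det_fderiv volume hA
          fun x hx => (hasFDerivAt_transfer D (hne x hx)).hasFDerivWithinAt
    _ ≤ ∫⁻ _ in A, ENNReal.ofReal (w⁻¹ - 1) := by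
        refine setLIntegral_mono measurable_const fun x hx => ENNReal.ofReal_le_ofReal ?_
        obtain ⟨g1, g2⟩ := h1 x hx
        have g3 : -x.1 > 0 := by linarith
        have e : x.1⁻¹ = -(-x.1)⁻¹ := by rw [inv_neg, neg_neg]
        have g4 : (-x.1)⁻¹ ≤ w⁻¹ := inv_anti₀ hw0 (by linarith)
        have g5 : 1 ≤ (-x.1)⁻¹ := (one_le_inv₀ g3).2 (by linarith)
        rw [det_transferDeriv, e, abs_of_nonpos (by linarith)]
        linarith
    _ = ENNReal.ofReal (w⁻¹ - 1) * volume A := by rw [setLIntegral_const]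
    _ < 1 * volume A := by
        rw [ENNReal.mul_lt_mul_iff_left h0 hfin]
        rw [← ENNReal.ofReal_one]
        exact (ENNReal.ofReal_lt_ofReal_iff one_pos).2 hc
    _ = volume A := one_mul _

/-! ### Two opposite arcs -/

/-- A domain in normalized coordinates: an edge on the line `x = 1` and two arcs completing it to
inscribed hexagons, together with a perturbation of the profile of the arcs. -/
structure IsTwoArc (K : Set (ℝ × ℝ)) (D a b w : ℝ) (y y1 Y Y1 : ℝ → ℝ) : Prop where
  cscd : IsCSCD K
  pos : 0 < D
  pert : IsPerturbation y y1 a b w Y Y1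
  small : b - a < D
  abs_le : ∀ x ∈ K, |x.1| ≤ 1
  edge : ∀ r ∈ Icc a b, (1, r) ∈ frontier K
  arcL : ∀ r ∈ Icc a b, rayPoint D (-1) r (y r) ∈ frontier K
  arcR : ∀ r ∈ Icc a b, rayPoint D 1 r (1 - y r) ∈ frontier K
  apex : ((0, D) : ℝ × ℝ) ∈ interior K
  tanL : ∀ ρ ∈ ({a, b} : Set ℝ), ∀ x ∈ K,
    tangentFun D (-1) (fun r => (Y r)⁻¹) (fun r => -Y1 r / Y r ^ 2) ρ x ≤ 1
  tanR : ∀ ρ ∈ ({a, b} : Set ℝ), ∀ x ∈ K,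
    tangentFun D 1 (fun r => (1 - Y r)⁻¹) (fun r => -(-Y1 r) / (1 - Y r) ^ 2) ρ x ≤ 1

/-- Replace the left arc. -/
def replaceLeft (K : Set (ℝ × ℝ)) (D a b : ℝ) (Y Y1 : ℝ → ℝ) : Set (ℝ × ℝ) :=
  replaceArc K D (-1) a b (fun r => (Y r)⁻¹) (fun r => -Y1 r / Y r ^ 2)

/-- Replace both arcs. -/
def replaceBoth (K : Set (ℝ × ℝ)) (D a b : ℝ) (Y Y1 : ℝ → ℝ) : Set (ℝ × ℝ) :=
  replaceArc (replaceLeft K D a b Y Y1) D 1 a b (fun r => (1 - Y r)⁻¹)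
    (fun r => -(-Y1 r) / (1 - Y r) ^ 2)

lemma rayPoint_notMem_sector {D κ a b r z : ℝ} (hz : 0 ≤ z) :
    rayPoint D κ r z ∉ sector D (-κ) a b := by
  intro h
  have := h.1
  simp only [rayPoint] at this
  nlinarith [mul_nonneg (mul_self_nonneg κ) hz]

lemma neg_rayPoint_notMem_sector {D κ κ' a b r z : ℝ} (hD : 0 < D) (hab : b - a < D)
    (hκ : κ = 1 ∨ κ = -1) (hκ' : κ' = 1 ∨ κ' = -1)
    (hr : r ∈ Icc a b) (hz : 0 ≤ z) (hz1 : z ≤ 1) :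
    -rayPoint D κ' r z ∉ sector D κ a b := by
  rintro ⟨h1, h2, h3⟩
  simp only [rayPoint, Prod.fst_neg, Prod.snd_neg] at h1 h2 h3
  have g1 : z * (r - a) ≤ b - a := by nlinarith [hr.1, hr.2]
  have g2 : z * (b - r) ≤ b - a := by nlinarith [hr.1, hr.2]
  rcases hκ with rfl | rfl <;> rcases hκ' with rfl | rfl <;> nlinarith

lemma edge_notMem_sector {D κ a b r : ℝ} (hab : b - a < D)
    (hκ : κ = 1 ∨ κ = -1) (hr : r ∈ Icc a b) :
    ((1, r) : ℝ × ℝ) ∉ sector D κ a b ∧ -((1, r) : ℝ × ℝ) ∉ sector D κ a b := by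
  obtain ⟨hr1, hr2⟩ := hr
  constructor <;> rintro ⟨h1, h2, h3⟩ <;> simp only [Prod.neg_mk] at h1 h2 h3 <;>
    rcases hκ with rfl | rfl <;> linarith

/-- Points between the apex and the boundary. -/
lemma rayPoint_mem_of_le {S : Set (ℝ × ℝ)} (hS : Convex ℝ S) {D κ r z ζ : ℝ}
    (h0 : ((0, D) : ℝ × ℝ) ∈ S) (hζ : rayPoint D κ r ζ ∈ S) (hz : 0 ≤ z) (hzζ : z ≤ ζ) :
    rayPoint D κ r z ∈ S := by
  rcases eq_or_lt_of_le (hz.trans hzζ) with h | h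
  · have : z = 0 := by linarith
    rw [this]
    simpa [rayPoint] using h0
  have : rayPoint D κ r z = (1 - z / ζ) • ((0, D) : ℝ × ℝ) + (z / ζ) • rayPoint D κ r ζ := by
    ext
    · simp only [rayPoint, Prod.fst_add, Prod.smul_fst, smul_eq_mul]
      field_simp
      ring
    · simp only [rayPoint, Prod.snd_add, Prod.smul_snd, smul_eq_mul]
      field_simp
      ring
  rw [this]
  exact hS h0 hζ (sub_nonneg.2 ((div_le_one h).2 hzζ)) (by positivity) (by ring)

lemma rayPoint_mem_interior_of_lt {S : Set (ℝ × ℝ)} (hS : Convex ℝ S) {D κ r z ζ : ℝ}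
    (h0 : ((0, D) : ℝ × ℝ) ∈ interior S) (hζ : rayPoint D κ r ζ ∈ S) (hz : 0 < z) (hzζ : z < ζ) :
    rayPoint D κ r z ∈ interior S := by
  have h : 0 < ζ := hz.trans hzζ
  refine hS.openSegment_interior_self_subset_interior h0 hζ
    ⟨1 - z / ζ, z / ζ, sub_pos.2 ((div_lt_one h).2 hzζ), by positivity, by ring, ?_⟩
  ext
  · simp only [rayPoint, Prod.fst_add, Prod.smul_fst, smul_eq_mul]
    field_simp
    ring
  · simp only [rayPoint, Prod.snd_add, Prod.smul_snd, smul_eq_mul]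
    field_simp
    ring

namespace IsTwoArc

variable {K : Set (ℝ × ℝ)} {D a b w : ℝ} {y y1 Y Y1 : ℝ → ℝ}

lemma lt (h : IsTwoArc K D a b w y y1 Y Y1) : a < b := h.pert.profL.lt

lemma bounds (h : IsTwoArc K D a b w y y1 Y Y1) {r : ℝ} (hr : r ∈ Icc a b) :
    1 / 2 < Y r ∧ Y r ≤ y r ∧ y r < 1 := by
  have h1 := h.pert.half_lt
  have h2 := h.pert.le_Y r hr
  exact ⟨by linarith, h.pert.Y_le r hr, h.pert.lt_one r hr⟩

lemma mem_of_frontier (h : IsTwoArc K D a b w y y1 Y Y1) {x : ℝ × ℝ} (hx : x ∈ frontier K) :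
    x ∈ K := (h.cscd.frontier_iff.1 hx).1

lemma replaceable_left (h : IsTwoArc K D a b w y y1 Y Y1) :
    IsReplaceable K D (-1) a b (fun r => (Y r)⁻¹) (fun r => -Y1 r / Y r ^ 2) where
  cscd := h.cscd
  prof := h.pert.profL
  sq := by norm_num
  apex := h.apex
  tan_left := h.tanL a (by simp)
  tan_right := h.tanL b (by simp)
  left_mem := by
    rw [inv_inv, h.pert.left]
    exact h.mem_of_frontier (h.arcL a h.pert.profL.a_mem)
  right_mem := by
    rw [inv_inv, h.pert.right]
    exact h.mem_of_frontier (h.arcL b h.pert.profL.b_mem)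

lemma cscd_replaceLeft (h : IsTwoArc K D a b w y y1 Y Y1) : IsCSCD (replaceLeft K D a b Y Y1) :=
  h.replaceable_left.isCSCD_replaceArc

lemma mem_of_mem_capL (h : IsTwoArc K D a b w y y1 Y Y1) {x : ℝ × ℝ}
    (hx : x ∈ arcCap D (-1) a b (fun r => (Y r)⁻¹) (fun r => -Y1 r / Y r ^ 2)) : x ∈ K := by
  obtain ⟨r, hr, z, hz, rfl, hzN⟩ :=
    h.pert.profL.exists_rayPoint_of_mem_arcCap (by norm_num) hx
  obtain ⟨b1, b2, b3⟩ := h.bounds hr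
  have : z ≤ Y r := by
    rw [← div_eq_mul_inv, div_le_one (by linarith)] at hzN
    exact hzN
  exact rayPoint_mem_of_le h.cscd.1 (interior_subset h.apex) (h.mem_of_frontier (h.arcL r hr))
    hz.le (by linarith)

lemma replaceLeft_subset (h : IsTwoArc K D a b w y y1 Y Y1) : replaceLeft K D a b Y Y1 ⊆ K := by
  rintro x ((hx | hx) | hx)
  · exact hx.1
  · exact h.mem_of_mem_capL hx
  · exact h.cscd.neg_mem_iff.1 (h.mem_of_mem_capL hx)

lemma arcR_mem_replaceLeft (h : IsTwoArc K D a b w y y1 Y Y1) {r : ℝ} (hr : r ∈ Icc a b) :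
    rayPoint D 1 r (1 - y r) ∈ replaceLeft K D a b Y Y1 := by
  obtain ⟨b1, b2, b3⟩ := h.bounds hr
  exact h.replaceable_left.mem_replaceArc_of_notMem_sector (h.mem_of_frontier (h.arcR r hr))
    (rayPoint_notMem_sector (by linarith))
    (neg_rayPoint_notMem_sector h.pos h.small (by simp) (by simp) hr (by linarith) (by linarith))

lemma replaceable_right (h : IsTwoArc K D a b w y y1 Y Y1) :
    IsReplaceable (replaceLeft K D a b Y Y1) D 1 a b (fun r => (1 - Y r)⁻¹)
      (fun r => -(-Y1 r) / (1 - Y r) ^ 2) where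
  cscd := h.cscd_replaceLeft
  prof := h.pert.profR
  sq := by norm_num
  apex := h.replaceable_left.apex_mem_interior
  tan_left := fun x hx => h.tanR a (by simp) x (h.replaceLeft_subset hx)
  tan_right := fun x hx => h.tanR b (by simp) x (h.replaceLeft_subset hx)
  left_mem := by
    rw [inv_inv, h.pert.left]
    exact h.arcR_mem_replaceLeft h.pert.profL.a_mem
  right_mem := by
    rw [inv_inv, h.pert.right]
    exact h.arcR_mem_replaceLeft h.pert.profL.b_mem

lemma cscd_replaceBoth (h : IsTwoArc K D a b w y y1 Y Y1) : IsCSCD (replaceBoth K D a b Y Y1) :=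
  h.replaceable_right.isCSCD_replaceArc

lemma newR_mem (h : IsTwoArc K D a b w y y1 Y Y1) {r : ℝ} (hr : r ∈ Icc a b) :
    rayPoint D 1 r (1 - Y r) ∈ replaceBoth K D a b Y Y1 := by
  have := h.replaceable_right.rayPoint_mem_replaceArc hr
  rwa [inv_inv] at this

lemma newL_mem (h : IsTwoArc K D a b w y y1 Y Y1) {r : ℝ} (hr : r ∈ Icc a b) :
    rayPoint D (-1) r (Y r) ∈ replaceBoth K D a b Y Y1 := by
  obtain ⟨b1, b2, b3⟩ := h.bounds hr
  have := h.replaceable_left.rayPoint_mem_replaceArc hr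
  rw [inv_inv] at this
  refine h.replaceable_right.mem_replaceArc_of_notMem_sector this ?_
    (neg_rayPoint_notMem_sector h.pos h.small (by simp) (by simp) hr (by linarith) (by linarith))
  have := rayPoint_notMem_sector (D := D) (κ := -1) (a := a) (b := b) (r := r) (z := Y r)
    (by linarith)
  rwa [neg_neg] at this

lemma edge_mem (h : IsTwoArc K D a b w y y1 Y Y1) {r : ℝ} (hr : r ∈ Icc a b) :
    (1, r) ∈ replaceBoth K D a b Y Y1 := by
  have h1 := edge_notMem_sector (κ := 1) h.small (by simp) hr
  have h2 := edge_notMem_sector (κ := -1) h.small (by simp) hr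
  exact h.replaceable_right.mem_replaceArc_of_notMem_sector
    (h.replaceable_left.mem_replaceArc_of_notMem_sector (h.mem_of_frontier (h.edge r hr))
      h2.1 h2.2) h1.1 h1.2

lemma dominated (h : IsTwoArc K D a b w y y1 Y Y1) : Dominated K (replaceBoth K D a b Y Y1) := by
  have hneg := fun x => h.cscd_replaceBoth.neg_mem (x := x)
  refine dominated_of_hexagons h.cscd h.cscd_replaceBoth h.pos (fun x hx => ?_)
    (h.edge a h.pert.profL.a_mem) (h.arcL a h.pert.profL.a_mem) ?_ ?_
  · have caseL : ∀ r ∈ Icc a b, ∀ x, x = rayPoint D (-1) r (Y r) → ∃ s ∈ replaceBoth K D a b Y Y1,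
        s + x ∈ replaceBoth K D a b Y Y1 ∧ wedge x s = D := by
      rintro r hr x rfl
      refine ⟨-rayPoint D 1 r (1 - Y r), hneg _ (h.newR_mem hr), ?_, ?_⟩
      · have : -rayPoint D 1 r (1 - Y r) + rayPoint D (-1) r (Y r) = -(1, r) := by
          simp only [rayPoint]
          ext <;> simp <;> ring
        rw [this]
        exact hneg _ (h.edge_mem hr)
      · simp only [wedge, rayPoint, Prod.fst_neg, Prod.snd_neg]
        ring
    have caseR : ∀ r ∈ Icc a b, ∀ x, x = rayPoint D 1 r (1 - Y r) →
        ∃ s ∈ replaceBoth K D a b Y Y1, s + x ∈ replaceBoth K D a b Y Y1 ∧ wedge x s = D := by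
      rintro r hr x rfl
      refine ⟨-(1, r), hneg _ (h.edge_mem hr), ?_, ?_⟩
      · have : -(1, r) + rayPoint D 1 r (1 - Y r) = rayPoint D (-1) r (Y r) := by
          simp only [rayPoint]
          ext <;> simp <;> ring
        rw [this]
        exact h.newL_mem hr
      · simp only [wedge, rayPoint, Prod.fst_neg, Prod.snd_neg]
        ring
    have neg_case : ∀ x, (∃ s ∈ replaceBoth K D a b Y Y1,
        s + -x ∈ replaceBoth K D a b Y Y1 ∧ wedge (-x) s = D) → ∃ s ∈ replaceBoth K D a b Y Y1,
        s + x ∈ replaceBoth K D a b Y Y1 ∧ wedge x s = D := by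
      rintro x ⟨s, hs, hsx, hw⟩
      refine ⟨-s, hneg _ hs, ?_, ?_⟩
      · have := hneg _ hsx
        rwa [neg_add, neg_neg] at this
      · rw [wedge_neg_right, ← wedge_neg_left]
        exact hw
    rcases h.replaceable_right.frontier_replaceArc hx with hx | ⟨r, hr, hx | hx⟩
    · rcases h.replaceable_left.frontier_replaceArc hx with hx | ⟨r, hr, hx | hx⟩
      · exact Or.inl hx
      · rw [inv_inv] at hx
        exact Or.inr (caseL r hr x hx)
      · rw [inv_inv] at hx
        exact Or.inr (neg_case x (caseL r hr _ hx))
    · rw [inv_inv] at hx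
      exact Or.inr (caseR r hr x hx)
    · rw [inv_inv] at hx
      exact Or.inr (neg_case x (caseR r hr _ hx))
  · have : rayPoint D (-1) a (y a) + (1, a) = rayPoint D 1 a (1 - y a) := by
      simp only [rayPoint]
      ext <;> simp <;> ring
    rw [this]
    exact h.arcR a h.pert.profL.a_mem
  · simp only [wedge, rayPoint]
    ring

lemma notMem_replaceBoth (h : IsTwoArc K D a b w y y1 Y Y1) {r z : ℝ} (hr : r ∈ Icc a b)
    (hz : Y r < z) (hz1 : z ≤ 1) : rayPoint D (-1) r z ∉ replaceBoth K D a b Y Y1 := by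
  obtain ⟨b1, b2, b3⟩ := h.bounds hr
  have hpos : 0 < Y r := by linarith
  have hR : rayPoint D (-1) r z ∉ sector D 1 a b := by
    have := rayPoint_notMem_sector (D := D) (κ := -1) (a := a) (b := b) (r := r) (z := z)
      (by linarith)
    rwa [neg_neg] at this
  have hn := fun κ hκ => neg_rayPoint_notMem_sector (κ := κ) (κ' := -1) h.pos h.small hκ
    (by simp) hr (by linarith) hz1
  have h1 : 1 < z * (Y r)⁻¹ := by
    rw [← div_eq_mul_inv, one_lt_div hpos]
    exact hz
  rintro ((⟨hx, -, -⟩ | hx) | hx)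
  · rcases hx with (⟨-, hx, -⟩ | hx) | hx
    · rw [secantFun_rayPoint (by norm_num)] at hx
      have := mul_le_mul_of_nonneg_left (h.pert.profL.le_secant hr) (by linarith : 0 ≤ z)
      linarith
    · have := hx.2 r hr
      rw [tangentFun_rayPoint (by norm_num), sub_self, mul_zero, add_zero] at this
      linarith
    · exact hn (-1) (by simp) (h.pert.profL.arcCap_subset_sector hx)
  · exact hR (h.pert.profR.arcCap_subset_sector hx)
  · exact hn 1 (by simp) (h.pert.profR.arcCap_subset_sector hx)

lemma notMem_interior_replaceBoth (h : IsTwoArc K D a b w y y1 Y Y1) {r z : ℝ} (hr : r ∈ Icc a b)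
    (hz : Y r ≤ z) (hz1 : z < 1) :
    rayPoint D (-1) r z ∉ interior (replaceBoth K D a b Y Y1) := by
  intro hx
  have hc : ContinuousAt (fun t => rayPoint D (-1) r t) z := by
    unfold rayPoint
    fun_prop
  have h1 := hc.preimage_mem_nhds (isOpen_interior.mem_nhds hx)
  have h2 : ∀ᶠ t in 𝓝[>] z, t < 1 ∧ rayPoint D (-1) r t ∈ interior (replaceBoth K D a b Y Y1) :=
    nhdsWithin_le_nhds ((eventually_lt_nhds hz1).and h1)
  obtain ⟨t, ⟨ht1, ht2⟩, ht3⟩ := (h2.and self_mem_nhdsWithin).exists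
  exact h.notMem_replaceBoth hr (hz.trans_lt ht3) ht1.le (interior_subset ht2)

end IsTwoArc

namespace IsTwoArc

variable {K : Set (ℝ × ℝ)} {D a b w : ℝ} {y y1 Y Y1 : ℝ → ℝ}

/-- The part of the domain lost near the left arc. -/
def lostRegion (K : Set (ℝ × ℝ)) (D a b w : ℝ) (Y Y1 : ℝ → ℝ) : Set (ℝ × ℝ) :=
  {x | (x ∈ K ∧ x ∉ interior (replaceBoth K D a b Y Y1)) ∧
    x.1 ≤ -w ∧ b * x.1 ≤ x.2 - D ∧ x.2 - D ≤ a * x.1}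

/-- The region gained near the right arc. -/
def gainedRegion (D a b : ℝ) (y Y : ℝ → ℝ) : Set (ℝ × ℝ) :=
  {x | ∃ r ∈ Icc a b, ∃ z, 1 - y r < z ∧ z ≤ 1 - Y r ∧ x = rayPoint D 1 r z}

lemma measurableSet_lostRegion (h : IsTwoArc K D a b w y y1 Y Y1) :
    MeasurableSet (lostRegion K D a b w Y Y1) := by
  have h1 : IsClosed {x : ℝ × ℝ | x ∈ K ∧ x ∉ interior (replaceBoth K D a b Y Y1)} :=
    h.cscd.isClosed.inter isOpen_interior.isClosed_compl
  have h2 : IsClosed {x : ℝ × ℝ | x.1 ≤ -w} := isClosed_le continuous_fst continuous_const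
  have h3 : IsClosed {x : ℝ × ℝ | b * x.1 ≤ x.2 - D} := isClosed_le (by fun_prop) (by fun_prop)
  have h4 : IsClosed {x : ℝ × ℝ | x.2 - D ≤ a * x.1} := isClosed_le (by fun_prop) (by fun_prop)
  exact (h1.inter (h2.inter (h3.inter h4))).measurableSet

lemma replaceBoth_subset (h : IsTwoArc K D a b w y y1 Y Y1) :
    replaceBoth K D a b Y Y1 ⊆ K ∪ gainedRegion D a b y Y ∪ -gainedRegion D a b y Y := by
  have key : ∀ x ∈ arcCap D 1 a b (fun r => (1 - Y r)⁻¹) (fun r => -(-Y1 r) / (1 - Y r) ^ 2),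
      x ∈ K ∨ x ∈ gainedRegion D a b y Y := by
    intro x hx
    obtain ⟨r, hr, z, hz, rfl, hzN⟩ :=
      h.pert.profR.exists_rayPoint_of_mem_arcCap (by norm_num) hx
    obtain ⟨b1, b2, b3⟩ := h.bounds hr
    rw [← div_eq_mul_inv, div_le_one (by linarith)] at hzN
    rcases le_or_gt z (1 - y r) with hc | hc
    · exact Or.inl (rayPoint_mem_of_le h.cscd.1 (interior_subset h.apex)
        (h.mem_of_frontier (h.arcR r hr)) hz.le hc)
    · exact Or.inr ⟨r, hr, z, hc, hzN, rfl⟩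
  rintro x ((hx | hx) | hx)
  · exact Or.inl (Or.inl (h.replaceLeft_subset hx.1))
  · exact Or.inl (key x hx)
  · rcases key _ hx with hx | hx
    · exact Or.inl (Or.inl (h.cscd.neg_mem_iff.1 hx))
    · exact Or.inr hx

lemma gainedRegion_subset (h : IsTwoArc K D a b w y y1 Y Y1) : gainedRegion D a b y Y ⊆
    (fun x : ℝ × ℝ => ((x.1 + 1, x.2 + (x.2 - D) * x.1⁻¹) : ℝ × ℝ)) ''
      lostRegion K D a b w Y Y1 := by
  rintro x ⟨r, hr, z, hz1, hz2, rfl⟩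
  obtain ⟨b1, b2, b3⟩ := h.bounds hr
  have hw := h.pert.le_Y r hr
  have hw2 := h.pert.half_lt
  have hpos : 0 < 1 - z := by linarith
  refine ⟨rayPoint D (-1) r (1 - z), ⟨⟨?_, ?_⟩, ?_, ?_, ?_⟩, ?_⟩
  · exact rayPoint_mem_of_le h.cscd.1 (interior_subset h.apex) (h.mem_of_frontier (h.arcL r hr))
      hpos.le (by linarith)
  · exact h.notMem_interior_replaceBoth hr (by linarith) (by linarith)
  · simp only [rayPoint]
    linarith
  · simp only [rayPoint]
    nlinarith [hr.2]
  · simp only [rayPoint]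
    nlinarith [hr.1]
  · have hne : -1 * (1 - z) ≠ 0 := by linarith
    simp only [rayPoint]
    ext
    · simp only
      ring
    · simp only
      field_simp
      ring

lemma volume_lostRegion_ne_zero (h : IsTwoArc K D a b w y y1 Y Y1) :
    volume (lostRegion K D a b w Y Y1) ≠ 0 := by
  have hab := h.lt
  set r := (a + b) / 2 with hrdef
  have hr : r ∈ Ioo a b := ⟨by linarith, by linarith⟩
  have hr' := Ioo_subset_Icc_self hr
  obtain ⟨b1, b2, b3⟩ := h.bounds hr'
  have hlt := h.pert.Y_lt r hr
  have hw := h.pert.le_Y r hr'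
  set z := (Y r + y r) / 2 with hz
  have o1 : IsOpen {x : ℝ × ℝ | x.1 < -w} := isOpen_lt continuous_fst continuous_const
  have o2 : IsOpen {x : ℝ × ℝ | b * x.1 < x.2 - D} := isOpen_lt (by fun_prop) (by fun_prop)
  have o3 : IsOpen {x : ℝ × ℝ | x.2 - D < a * x.1} := isOpen_lt (by fun_prop) (by fun_prop)
  have hO : IsOpen ((interior K ∩ (replaceBoth K D a b Y Y1)ᶜ) ∩ ({x : ℝ × ℝ | x.1 < -w} ∩
      ({x : ℝ × ℝ | b * x.1 < x.2 - D} ∩ {x : ℝ × ℝ | x.2 - D < a * x.1}))) :=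
    (isOpen_interior.inter h.cscd_replaceBoth.isClosed.isOpen_compl).inter (o1.inter (o2.inter o3))
  refine ((hO.measure_pos volume ⟨rayPoint D (-1) r z, ⟨?_, ?_⟩, ?_, ?_, ?_⟩).trans_le
    (measure_mono ?_)).ne'
  · exact rayPoint_mem_interior_of_lt h.cscd.1 h.apex (h.mem_of_frontier (h.arcL r hr'))
      (by linarith) (by linarith)
  · exact h.notMem_replaceBoth hr' (by linarith) (by linarith)
  · change -1 * z < -w
    linarith
  · change b * (-1 * z) < D + -1 * (z * r) - D
    nlinarith [hr.2]
  · change D + -1 * (z * r) - D < a * (-1 * z)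
    nlinarith [hr.1]
  · rintro x ⟨⟨h1, h2⟩, h3, h4, h5⟩
    exact ⟨⟨interior_subset h1, fun hi => h2 (interior_subset hi)⟩, le_of_lt h3, le_of_lt h4,
      le_of_lt h5⟩

lemma volume_gainedRegion_lt (h : IsTwoArc K D a b w y y1 Y Y1) :
    volume (gainedRegion D a b y Y) < volume (lostRegion K D a b w Y Y1) := by
  refine (measure_mono h.gainedRegion_subset).trans_lt (volume_transfer_lt h.pert.half_lt
    h.measurableSet_lostRegion (fun x hx => ⟨(_root_.abs_le.1 (h.abs_le x hx.1.1)).1, hx.2.1⟩)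
    h.volume_lostRegion_ne_zero ?_)
  exact ((measure_mono fun x hx => hx.1.1).trans_lt h.cscd.2.1.measure_lt_top).ne

lemma volume_replaceBoth_lt (h : IsTwoArc K D a b w y y1 Y Y1) :
    volume (replaceBoth K D a b Y Y1) < volume K := by
  set A := lostRegion K D a b w Y Y1 with hA
  set B := gainedRegion D a b y Y with hB
  have hmA : MeasurableSet A := h.measurableSet_lostRegion
  have hmA' : MeasurableSet (-A) := hmA.neg
  have hAK : A ∪ -A ⊆ K := by
    rintro x (hx | hx)
    · exact hx.1.1
    · exact h.cscd.neg_mem_iff.1 hx.1.1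
  have hdisj : Disjoint A (-A) := by
    rw [Set.disjoint_left]
    intro x hx hx'
    have h1 := hx.2.1
    have h2 : -x.1 ≤ -w := hx'.2.1
    have := h.pert.half_lt
    linarith
  have hKd : volume (K \ (A ∪ -A)) + (volume A + volume A) = volume K := by
    have e : volume (A ∪ -A) = volume A + volume A := by
      rw [measure_union hdisj hmA', Measure.measure_neg]
    rw [← e]
    rw [add_comm, measure_add_sdiff (hmA.union hmA').nullMeasurableSet,
      union_eq_self_of_subset_left hAK]
  have h_in : volume (replaceBoth K D a b Y Y1) =
      volume (interior (replaceBoth K D a b Y Y1)) := by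
    refine le_antisymm ?_ (measure_mono interior_subset)
    calc _ ≤ volume (interior (replaceBoth K D a b Y Y1) ∪ frontier (replaceBoth K D a b Y Y1)) :=
          measure_mono (by rw [← closure_eq_interior_union_frontier]; exact subset_closure)
      _ ≤ _ + volume (frontier (replaceBoth K D a b Y Y1)) := measure_union_le _ _
      _ = _ := by rw [h.cscd_replaceBoth.1.addHaar_frontier volume, add_zero]
  have hsub : interior (replaceBoth K D a b Y Y1) ⊆ (K \ (A ∪ -A)) ∪ (B ∪ -B) := by
    intro x hx
    have hnx : -x ∈ interior (replaceBoth K D a b Y Y1) :=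
      h.cscd_replaceBoth.neg_interior hx
    rcases h.replaceBoth_subset (interior_subset hx) with (hx' | hx') | hx'
    · refine Or.inl ⟨hx', ?_⟩
      rintro (hc | hc)
      · exact hc.1.2 hx
      · exact hc.1.2 hnx
    · exact Or.inr (Or.inl hx')
    · exact Or.inr (Or.inr hx')
  have hlt := h.volume_gainedRegion_lt
  rw [h_in, ← hKd]
  calc _ ≤ volume ((K \ (A ∪ -A)) ∪ (B ∪ -B)) := measure_mono hsub
    _ ≤ volume (K \ (A ∪ -A)) + volume (B ∪ -B) := measure_union_le _ _
    _ ≤ volume (K \ (A ∪ -A)) + (volume B + volume B) := by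
        gcongr
        refine (measure_union_le _ _).trans ?_
        rw [Measure.measure_neg]
    _ < volume (K \ (A ∪ -A)) + (volume A + volume A) := by
        refine ENNReal.add_lt_add_left ?_ (ENNReal.add_lt_add hlt hlt)
        exact ((measure_mono sdiff_subset).trans_lt h.cscd.2.1.measure_lt_top).ne

lemma improvable (h : IsTwoArc K D a b w y y1 Y Y1) : Improvable K :=
  ⟨_, h.cscd_replaceBoth, h.volume_replaceBoth_lt, h.dominated⟩

end IsTwoArc

/-! ### Domains with an edge and two curved arcs can be improved -/

lemma apex_mem_interior_of_arcs {K : Set (ℝ × ℝ)} (hK : IsCSCD K) {D ρ : ℝ} {y : ℝ → ℝ}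
    (hy : ∀ᶠ r in 𝓝 ρ, 0 < y r ∧ y r < 1) (hL : ∀ᶠ r in 𝓝 ρ, rayPoint D (-1) r (y r) ∈ K)
    (hR : ∀ᶠ r in 𝓝 ρ, rayPoint D 1 r (1 - y r) ∈ K) : ((0, D) : ℝ × ℝ) ∈ interior K := by
  by_contra hc
  obtain ⟨α, β, hs, hle⟩ := exists_support hK.1 hK.2.2.1 hc
  have key : ∀ᶠ r in 𝓝 ρ, α + β * r = 0 := by
    filter_upwards [hy, hL, hR] with r hyr hLr hRr
    have h1 := hle _ hLr
    have h2 := hle _ hRr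
    simp only [rayPoint] at h1 h2
    have h3 : 0 ≤ y r * (α + β * r) := by linarith
    have h4 : (1 - y r) * (α + β * r) ≤ 0 := by linarith
    have h5 := nonneg_of_mul_nonneg_right h3 hyr.1
    have h6 := nonpos_of_mul_nonpos_right h4 (by linarith)
    linarith
  have h0 := key.self_of_nhds
  obtain ⟨r, hr, hlt⟩ := ((key.filter_mono nhdsWithin_le_nhds).and
    (self_mem_nhdsWithin (a := ρ) (s := Ioi ρ))).exists
  have hβ : β = 0 := by
    have : β * (r - ρ) = 0 := by linarith
    exact (mul_eq_zero.1 this).resolve_right (sub_pos.2 hlt).ne'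
  have hα : α = 0 := by rw [hβ] at h0; linarith
  obtain ⟨x, hx⟩ := hK.2.2.1
  have := hs x hx
  rw [hα, hβ] at this
  norm_num at this

lemma improvable_of_half_lt {K : Set (ℝ × ℝ)} (hK : IsCSCD K) {D ρ : ℝ} (hD : 0 < D)
    {y y1 y2 : ℝ → ℝ} (h1 : ∀ᶠ r in 𝓝 ρ, HasDerivAt y (y1 r) r)
    (h2 : ∀ᶠ r in 𝓝 ρ, HasDerivAt y1 (y2 r) r) (h3 : ContinuousAt y2 ρ)
    (hX : ∀ x ∈ K, |x.1| ≤ 1) (hE : ∀ᶠ r in 𝓝 ρ, (1, r) ∈ frontier K)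
    (hL : ∀ᶠ r in 𝓝 ρ, rayPoint D (-1) r (y r) ∈ frontier K)
    (hR : ∀ᶠ r in 𝓝 ρ, rayPoint D 1 r (1 - y r) ∈ frontier K)
    (hl : 1 / 2 < y ρ) (hr : y ρ < 1)
    (neL : 2 * y1 ρ ^ 2 - y ρ * y2 ρ ≠ 0) (neR : 2 * y1 ρ ^ 2 + (1 - y ρ) * y2 ρ ≠ 0) :
    Improvable K := by
  have hmem : ∀ {x}, x ∈ frontier K → x ∈ K := fun hx => (hK.frontier_iff.1 hx).1
  have hc0 : ContinuousAt y ρ := h1.self_of_nhds.continuousAt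
  have hy : ∀ᶠ r in 𝓝 ρ, 1 / 2 < y r ∧ y r < 1 :=
    (hc0.eventually_const_lt hl).and (hc0.eventually_lt_const hr)
  have hapex : ((0, D) : ℝ × ℝ) ∈ interior K :=
    apex_mem_interior_of_arcs hK (hy.mono fun r hr => ⟨by linarith [hr.1], hr.2⟩)
      (hL.mono fun r hr => hmem hr) (hR.mono fun r hr => hmem hr)
  have cL := curvature_pos hK (by norm_num) hapex (by linarith : 0 < y ρ) h1 h2 h3 hL neL
  have cR := curvature_pos hK (by norm_num) hapex (z := fun r => 1 - y r) (z' := fun r => -y1 r)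
    (z'' := fun r => -y2 r) (by linarith) (h1.mono fun r hr => hr.const_sub 1)
    (h2.mono fun r hr => hr.fun_neg) h3.fun_neg hR (by convert neR using 1; ring)
  obtain ⟨a, b, w, Y, Y1, hsmall, hsub, hpert⟩ := exists_perturbation h1 h2 h3 hl hr cL
    (by linarith)
    (h1.and (hE.and (hL.eventually_nhds.and hR.eventually_nhds))) hD
  have ha := hpert.profL.a_mem
  have hb := hpert.profL.b_mem
  have hends : ∀ s ∈ ({a, b} : Set ℝ), s ∈ Icc a b ∧ Y s = y s ∧ Y1 s = y1 s := by
    rintro s (rfl | rfl)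
    · exact ⟨ha, hpert.left, hpert.left1⟩
    · exact ⟨hb, hpert.right, hpert.right1⟩
  have hbd : ∀ s ∈ Icc a b, 0 < y s ∧ y s < 1 := fun s hs => by
    have g1 := hpert.half_lt
    have g2 := hpert.le_Y s hs
    have g3 := hpert.Y_le s hs
    exact ⟨by linarith, hpert.lt_one s hs⟩
  have htwo : IsTwoArc K D a b w y y1 Y Y1 :=
    { cscd := hK
      pos := hD
      pert := hpert
      small := hsmall
      abs_le := hX
      edge := fun s hs => (hsub hs).2.1
      arcL := fun s hs => (hsub hs).2.2.1.self_of_nhds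
      arcR := fun s hs => (hsub hs).2.2.2.self_of_nhds
      apex := hapex
      tanL := fun s hs x hx => by
        obtain ⟨hsI, e0, e1⟩ := hends s hs
        exact tangentFun_le_one hK (by norm_num) hapex (hbd s hsI).1 (hsub hsI).1
          (hsub hsI).2.2.1.self_of_nhds ((hsub hsI).2.2.1.mono fun r hr => hmem hr)
          (by rw [e0]) (by rw [e0, e1]) hx
      tanR := fun s hs x hx => by
        obtain ⟨hsI, e0, e1⟩ := hends s hs
        exact tangentFun_le_one (z := fun r => 1 - y r) hK (by norm_num) hapex
          (by linarith [(hbd s hsI).2]) ((hsub hsI).1.const_sub 1)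
          (hsub hsI).2.2.2.self_of_nhds ((hsub hsI).2.2.2.mono fun r hr => hmem hr)
          (by rw [e0]) (by rw [e0, e1]) hx }
  exact htwo.improvable

/-- A domain having an edge on the line `x = 1` and two curved arcs which complete the edge to
inscribed hexagons is improvable. -/
lemma improvable_of_arcs {K : Set (ℝ × ℝ)} (hK : IsCSCD K) {D ρ : ℝ} (hD : 0 < D)
    {y y1 y2 : ℝ → ℝ} (h1 : ∀ᶠ r in 𝓝 ρ, HasDerivAt y (y1 r) r)
    (h2 : ∀ᶠ r in 𝓝 ρ, HasDerivAt y1 (y2 r) r) (h3 : ContinuousAt y2 ρ)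
    (hX : ∀ x ∈ K, |x.1| ≤ 1) (hE : ∀ᶠ r in 𝓝 ρ, (1, r) ∈ frontier K)
    (hL : ∀ᶠ r in 𝓝 ρ, rayPoint D (-1) r (y r) ∈ frontier K)
    (hR : ∀ᶠ r in 𝓝 ρ, rayPoint D 1 r (1 - y r) ∈ frontier K)
    (h0 : 0 < y ρ) (hhalf : y ρ ≠ 1 / 2) (hr : y ρ < 1)
    (neL : 2 * y1 ρ ^ 2 - y ρ * y2 ρ ≠ 0) (neR : 2 * y1 ρ ^ 2 + (1 - y ρ) * y2 ρ ≠ 0) :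
    Improvable K := by
  rcases hhalf.lt_or_gt with hlt | hgt
  swap
  · exact improvable_of_half_lt hK hD h1 h2 h3 hX hE hL hR hgt hr neL neR
  have hw : wedge (-1, 0) (0, 1) ≠ 0 := by simp [wedge]
  set T := basisEquiv (-1, 0) (0, 1) hw with hT
  have hTx : ∀ x : ℝ × ℝ, T x = (-x.1, x.2) := fun x => by
    rw [hT, basisEquiv_apply]
    ext <;> simp
  have hneg : Tendsto (fun r : ℝ => -r) (𝓝 (-ρ)) (𝓝 ρ) := by
    have := (continuous_neg (G := ℝ)).tendsto (-ρ)
    rwa [neg_neg] at this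
  have hd : ∀ (f : ℝ → ℝ) (f' r : ℝ), HasDerivAt f f' (-r) →
      HasDerivAt (fun r => f (-r)) (-f') r := fun f f' r hf =>
    (HasDerivAt.comp (h₂ := f) r hf (hasDerivAt_neg' r)).congr_deriv (by ring)
  refine improvable_of_preimage T (improvable_of_half_lt (isCSCD_preimage hK T) (ρ := -ρ) hD
    (y := fun r => 1 - y (-r)) (y1 := fun r => y1 (-r)) (y2 := fun r => -y2 (-r))
    ?_ ?_ ?_ ?_ ?_ ?_ ?_ ?_ ?_ ?_ ?_)
  · filter_upwards [hneg.eventually h1] with r hr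
    simpa using (hd _ _ _ hr).const_sub 1
  · filter_upwards [hneg.eventually h2] with r hr
    exact hd _ _ _ hr
  · refine ContinuousAt.fun_neg ?_
    refine ContinuousAt.comp (g := y2) ?_ continuous_neg.continuousAt
    rwa [neg_neg]
  · intro x hx
    have := hX _ hx
    rwa [hTx, abs_neg] at this
  · filter_upwards [hneg.eventually hE] with r hr
    rw [mem_frontier_preimage, hTx]
    have := hK.neg_frontier hr
    simpa using this
  · filter_upwards [hneg.eventually hR] with r hr
    rw [mem_frontier_preimage, hTx]
    convert hr using 1
    simp only [rayPoint]
    ext <;> simp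
  · filter_upwards [hneg.eventually hL] with r hr
    rw [mem_frontier_preimage, hTx]
    convert hr using 1
    simp only [rayPoint]
    ext <;> simp
  · simp only [neg_neg]
    linarith
  · simp only [neg_neg]
    linarith
  · simp only [neg_neg]
    convert neR using 1
    ring
  · simp only [neg_neg]
    convert neL using 1
    ring

/-! ### From parametrized arcs to improvability -/

lemma ContDiffAt.hasDerivAt_two {E : Type*} [NormedAddCommGroup E] [NormedSpace ℝ E]
    {f : ℝ → E} {x : ℝ} (h : ContDiffAt ℝ 2 f x) :
    (∀ᶠ z in 𝓝 x, HasDerivAt f (deriv f z) z) ∧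
      (∀ᶠ z in 𝓝 x, HasDerivAt (deriv f) (deriv (deriv f) z) z) ∧
      ContinuousAt (deriv (deriv f)) x := by
  have h1 : ContDiffAt ℝ 1 (deriv f) x := h.derivWithin (by norm_num)
  refine ⟨?_, ?_, (h1.derivWithin (m := 0) (by norm_num)).continuousAt⟩
  · filter_upwards [h.eventually (by simp)] with z hz
    exact (hz.differentiableAt (by simp)).hasDerivAt
  · filter_upwards [h1.eventually (by simp)] with z hz
    exact (hz.differentiableAt (by simp)).hasDerivAt

/-- A vertical edge through `(1, r)` with `r` moving confines `K` to the strip `|x| ≤ 1`. -/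
lemma abs_fst_le_one_of_edge {K : Set (ℝ × ℝ)} (hK : IsCSCD K) {r : ℝ → ℝ} {t r' : ℝ}
    (hr : HasDerivAt r r' t) (hr' : r' ≠ 0) (hE : ∀ᶠ s in 𝓝 t, ((1, r s) : ℝ × ℝ) ∈ frontier K) :
    ∀ x ∈ K, |x.1| ≤ 1 := by
  have hx := hK.frontier_iff.1 hE.self_of_nhds
  obtain ⟨α, β, hs, hle⟩ := exists_support hK.1 hK.2.2.1 hx.2
  have hmax : IsLocalMax (fun s => α * 1 + β * r s) t := by
    filter_upwards [hE] with s hsE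
    exact hle _ (hK.frontier_iff.1 hsE).1
  have hd := hmax.hasDerivAt_eq_zero ((hr.const_mul β).const_add (α * 1))
  have hβ : β = 0 := by simpa [hr'] using hd
  subst hβ
  have hα : 0 < α := by simpa using hs 0 hK.zero_mem_interior
  intro x hxK
  have h1 := hle x hxK
  have h2 := hle (-x) (hK.neg_mem hxK)
  simp only [Prod.fst_neg, zero_mul, add_zero, mul_one] at h1 h2
  rw [_root_.abs_le]
  constructor <;> nlinarith

lemma improvable_of_arc_at {K : Set (ℝ × ℝ)} (hK : IsCSCD K) {D t : ℝ} (hD : 0 < D)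
    {r y : ℝ → ℝ} (hr : ContDiffAt ℝ 2 r t) (hy : ContDiffAt ℝ 2 y t)
    (hX : ∀ x ∈ K, |x.1| ≤ 1)
    (hE : ∀ᶠ s in 𝓝 t, ((1, r s) : ℝ × ℝ) ∈ frontier K)
    (hL : ∀ᶠ s in 𝓝 t, rayPoint D (-1) (r s) (y s) ∈ frontier K)
    (hR : ∀ᶠ s in 𝓝 t, rayPoint D 1 (r s) (1 - y s) ∈ frontier K)
    (hr' : deriv r t ≠ 0) (h0 : 0 < y t) (hhalf : y t ≠ 1 / 2) (h1 : y t < 1)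
    (hCL : y t * deriv y t * deriv (deriv r) t + 2 * deriv r t * deriv y t ^ 2
      - deriv r t * y t * deriv (deriv y) t ≠ 0)
    (hCR : -((1 - y t) * deriv y t * deriv (deriv r) t) + 2 * deriv r t * deriv y t ^ 2
      + deriv r t * (1 - y t) * deriv (deriv y) t ≠ 0) : Improvable K := by
  have hd : HasDerivAt r (deriv r t) t := (hr.differentiableAt (by simp)).hasDerivAt
  have hstrict : HasStrictFDerivAt r
      ((ContinuousLinearEquiv.unitsEquivAut ℝ (Units.mk0 (deriv r t) hr')) : ℝ →L[ℝ] ℝ) t :=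
    (hr.hasStrictDerivAt' hd (by simp)).hasStrictFDerivAt_equiv hr'
  set g := hr.localInverse hstrict.hasFDerivAt (by simp) with hg
  have hgt : g (r t) = t := hr.localInverse_apply_image hstrict.hasFDerivAt (by simp)
  have hgC : ContDiffAt ℝ 2 g (r t) := hr.to_localInverse hstrict.hasFDerivAt (by simp)
  have hleft : ∀ᶠ s in 𝓝 t, g (r s) = s := hstrict.eventually_left_inverse
  have hright : ∀ᶠ ρ in 𝓝 (r t), r (g ρ) = ρ := hstrict.eventually_right_inverse
  have hgtend : Tendsto g (𝓝 (r t)) (𝓝 t) := by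
    have := hgC.continuousAt.tendsto
    rwa [hgt] at this
  set f := y ∘ g with hf
  have hfC : ContDiffAt ℝ 2 f (r t) := ContDiffAt.comp (r t) (by rwa [hgt]) hgC
  obtain ⟨hf1, hf2, hf3⟩ := hfC.hasDerivAt_two
  obtain ⟨hr1, hr2, -⟩ := hr.hasDerivAt_two
  have hft : f (r t) = y t := by rw [hf, Function.comp_apply, hgt]
  have hrt : Tendsto r (𝓝 t) (𝓝 (r t)) := hr.continuousAt
  have hyf : y =ᶠ[𝓝 t] fun s => f (r s) := by
    filter_upwards [hleft] with s hs
    rw [hf, Function.comp_apply, hs]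
  have hy1 : deriv y =ᶠ[𝓝 t] fun s => deriv f (r s) * deriv r s := by
    filter_upwards [hyf.eventuallyEq_nhds, hrt.eventually hf1, hr1] with s hs hfs hrs
    rw [hs.deriv_eq]
    exact (HasDerivAt.comp (h₂ := f) s hfs hrs).deriv
  have hy1t : deriv y t = deriv f (r t) * deriv r t := hy1.self_of_nhds
  have hy2t : deriv (deriv y) t = deriv (deriv f) (r t) * deriv r t ^ 2
      + deriv f (r t) * deriv (deriv r) t := by
    rw [hy1.deriv_eq]
    exact ((HasDerivAt.comp (h₂ := deriv f) t hf2.self_of_nhds hr1.self_of_nhds).fun_mul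
      hr2.self_of_nhds |>.congr_deriv (by simp only [Function.comp_apply]; ring)).deriv
  refine improvable_of_arcs hK (ρ := r t) hD hf1 hf2 hf3 hX ?_ ?_ ?_
    (by rwa [hft]) (by rwa [hft]) (by rwa [hft]) ?_ ?_
  · filter_upwards [hgtend.eventually hE, hright] with ρ h1 h2
    rwa [h2] at h1
  · filter_upwards [hgtend.eventually hL, hright] with ρ h1 h2
    rwa [h2] at h1
  · filter_upwards [hgtend.eventually hR, hright] with ρ h1 h2
    rwa [h2] at h1
  · intro hz
    refine hCL ?_
    rw [hy1t, hy2t]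
    rw [hft] at hz
    linear_combination deriv r t ^ 3 * hz
  · intro hz
    refine hCR ?_
    rw [hy1t, hy2t]
    rw [hft] at hz
    linear_combination deriv r t ^ 3 * hz

lemma improvable_of_normalized_arcs {K : Set (ℝ × ℝ)} (hK : IsCSCD K) {D t₀ t₁ : ℝ} (hD : 0 < D)
    (ht : t₀ < t₁) {r y : ℝ → ℝ} (hr : ∀ t ∈ Ioo t₀ t₁, ContDiffAt ℝ 2 r t)
    (hy : ∀ t ∈ Ioo t₀ t₁, ContDiffAt ℝ 2 y t)
    (hE : ∀ t ∈ Ioo t₀ t₁, ((1, r t) : ℝ × ℝ) ∈ frontier K)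
    (hL : ∀ t ∈ Ioo t₀ t₁, rayPoint D (-1) (r t) (y t) ∈ frontier K)
    (hR : ∀ t ∈ Ioo t₀ t₁, rayPoint D 1 (r t) (1 - y t) ∈ frontier K)
    (hr' : ∀ t ∈ Ioo t₀ t₁, deriv r t ≠ 0)
    (hCL : ∀ t ∈ Ioo t₀ t₁, y t * deriv y t * deriv (deriv r) t
      + 2 * deriv r t * deriv y t ^ 2 - deriv r t * y t * deriv (deriv y) t ≠ 0)
    (hCR : ∀ t ∈ Ioo t₀ t₁, -((1 - y t) * deriv y t * deriv (deriv r) t)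
      + 2 * deriv r t * deriv y t ^ 2 + deriv r t * (1 - y t) * deriv (deriv y) t ≠ 0) :
    Improvable K := by
  have hnhds : ∀ t ∈ Ioo t₀ t₁, ∀ᶠ s in 𝓝 t, s ∈ Ioo t₀ t₁ := fun t h => isOpen_Ioo.mem_nhds h
  obtain ⟨m, hm⟩ := nonempty_Ioo.2 ht
  have hX : ∀ x ∈ K, |x.1| ≤ 1 := by
    refine abs_fst_le_one_of_edge hK ((hr m hm).differentiableAt (by simp)).hasDerivAt
      (hr' m hm) ?_
    filter_upwards [hnhds m hm] with s hs using hE s hs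
  have hyI : ∀ t ∈ Ioo t₀ t₁, 0 ≤ y t ∧ y t ≤ 1 := by
    intro t htI
    have h1 := _root_.abs_le.1 (hX _ (hK.frontier_iff.1 (hL t htI)).1)
    have h2 := _root_.abs_le.1 (hX _ (hK.frontier_iff.1 (hR t htI)).1)
    simp only [rayPoint] at h1 h2
    constructor <;> linarith [h1.1, h1.2, h2.1, h2.2]
  obtain ⟨a, haI, ha⟩ : ∃ t ∈ Ioo t₀ t₁, deriv y t ≠ 0 := by
    by_contra! hc
    have h0 : deriv y =ᶠ[𝓝 m] fun _ => (0 : ℝ) := by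
      filter_upwards [hnhds m hm] with s hs using hc s hs
    refine hCL m hm ?_
    rw [hc m hm, h0.deriv_eq, deriv_const]
    ring
  have hda := ((hy a haI).differentiableAt (by simp)).hasDerivAt
  have hev : ∀ᶠ s in 𝓝[≠] a, s ∈ Ioo t₀ t₁ ∧ y s ≠ 0 ∧ y s ≠ 1 / 2 ∧ y s ≠ 1 := by
    filter_upwards [(hnhds a haI).filter_mono nhdsWithin_le_nhds, hda.eventually_ne (c := 0) ha,
      hda.eventually_ne (c := 1 / 2) ha, hda.eventually_ne (c := 1) ha] with s h1 h2 h3 h4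
    exact ⟨h1, h2, h3, h4⟩
  obtain ⟨b, hb, hb0, hbh, hb1⟩ := hev.exists
  have hbn := hnhds b hb
  exact improvable_of_arc_at hK hD (hr b hb) (hy b hb) hX (hbn.mono hE) (hbn.mono hL)
    (hbn.mono hR) (hr' b hb) (lt_of_le_of_ne (hyI b hb).1 hb0.symm) hbh
    (lt_of_le_of_ne (hyI b hb).2 hb1) (hCL b hb) (hCR b hb)

lemma hasDerivAt_coords {p v : ℝ × ℝ} {a b : ℝ → ℝ} {a' b' t : ℝ} (ha : HasDerivAt a a' t)
    (hb : HasDerivAt b b' t) :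
    HasDerivAt (fun s => a s • p + b s • v) (a' • p + b' • v) t :=
  (ha.smul_const p).fun_add (hb.smul_const v)

lemma wedge_coords (p v : ℝ × ℝ) (a b c d : ℝ) :
    wedge (a • p + b • v) (c • p + d • v) = (a * d - b * c) * wedge p v := by
  simp only [wedge, Prod.fst_add, Prod.snd_add, Prod.smul_fst, Prod.smul_snd, smul_eq_mul]
  ring

lemma ContDiffAt.wedge_left {s : ℝ → ℝ × ℝ} {t : ℝ} (h : ContDiffAt ℝ 2 s t) (p : ℝ × ℝ) :
    ContDiffAt ℝ 2 (fun x => wedge p (s x)) t := by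
  unfold wedge
  fun_prop

/-- The curvature of a curve given by `C²` coordinates in the basis `p`, `v`. -/
lemma wedge_deriv_coords {p v : ℝ × ℝ} {a b : ℝ → ℝ} {t : ℝ} {u : ℝ → ℝ × ℝ}
    (ha : ContDiffAt ℝ 2 a t) (hb : ContDiffAt ℝ 2 b t)
    (hu : u =ᶠ[𝓝 t] fun s => a s • p + b s • v) :
    wedge (deriv u t) (deriv (deriv u) t) =
      (deriv a t * deriv (deriv b) t - deriv b t * deriv (deriv a) t) * wedge p v := by
  obtain ⟨ha1, ha2, -⟩ := ha.hasDerivAt_two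
  obtain ⟨hb1, hb2, -⟩ := hb.hasDerivAt_two
  have h1 : deriv u =ᶠ[𝓝 t] fun s => deriv a s • p + deriv b s • v := by
    filter_upwards [hu.eventuallyEq_nhds, ha1, hb1] with s hs has hbs
    rw [hs.deriv_eq]
    exact (hasDerivAt_coords has hbs).deriv
  rw [h1.deriv_eq, h1.self_of_nhds,
    (hasDerivAt_coords ha2.self_of_nhds hb2.self_of_nhds).deriv, wedge_coords]

/-- First and second derivative of a product plus a constant. -/
lemma deriv_two_const_add_mul {r y : ℝ → ℝ} {t : ℝ} (D : ℝ) (hr : ContDiffAt ℝ 2 r t)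
    (hy : ContDiffAt ℝ 2 y t) :
    deriv (fun s => D + r s * y s) t = deriv r t * y t + r t * deriv y t ∧
      deriv (deriv fun s => D + r s * y s) t =
        deriv (deriv r) t * y t + 2 * (deriv r t * deriv y t) + r t * deriv (deriv y) t := by
  obtain ⟨hr1, hr2, -⟩ := hr.hasDerivAt_two
  obtain ⟨hy1, hy2, -⟩ := hy.hasDerivAt_two
  have h1 : deriv (fun s => D + r s * y s) =ᶠ[𝓝 t]
      fun s => deriv r s * y s + r s * deriv y s := by
    filter_upwards [hr1, hy1] with s hrs hys
    exact ((hrs.fun_mul hys).const_add D).deriv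
  refine ⟨h1.self_of_nhds, ?_⟩
  rw [h1.deriv_eq]
  exact (((hr2.self_of_nhds.fun_mul hy1.self_of_nhds).fun_add
    (hr1.self_of_nhds.fun_mul hy2.self_of_nhds)).congr_deriv (by ring)).deriv

lemma improvable_of_edge_of_pos {K : Set (ℝ × ℝ)} (hK : IsCSCD K) {t₀ t₁ c : ℝ} (hc : 0 < c)
    (ht : t₀ < t₁) {s u w : ℝ → ℝ × ℝ} {p v : ℝ × ℝ} (hpv : 0 < wedge p v)
    (hs : ∀ t ∈ Ioo t₀ t₁, ContDiffAt ℝ 2 s t) (hu : ∀ t ∈ Ioo t₀ t₁, ContDiffAt ℝ 2 u t)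
    (hline : ∀ t ∈ Ioo t₀ t₁, ∃ r : ℝ, s t = p + r • v)
    (hsum : ∀ t ∈ Ioo t₀ t₁, s t + u t + w t = 0)
    (hwedge : ∀ t ∈ Ioo t₀ t₁, wedge (s t) (u t) = c)
    (hsF : ∀ t ∈ Ioo t₀ t₁, s t ∈ frontier K) (huF : ∀ t ∈ Ioo t₀ t₁, u t ∈ frontier K)
    (hwF : ∀ t ∈ Ioo t₀ t₁, w t ∈ frontier K) (hs' : ∀ t ∈ Ioo t₀ t₁, deriv s t ≠ 0)
    (hCu : ∀ t ∈ Ioo t₀ t₁, wedge (deriv u t) (deriv (deriv u) t) ≠ 0)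
    (hCw : ∀ t ∈ Ioo t₀ t₁, wedge (deriv w t) (deriv (deriv w) t) ≠ 0) : Improvable K := by
  have hnhds : ∀ t ∈ Ioo t₀ t₁, ∀ᶠ s in 𝓝 t, s ∈ Ioo t₀ t₁ := fun t h => isOpen_Ioo.mem_nhds h
  set q := wedge p v with hq
  set r : ℝ → ℝ := fun t => q⁻¹ * wedge p (s t) with hr
  set y : ℝ → ℝ := fun t => q⁻¹ * wedge v (u t) with hy
  set D := q⁻¹ * c with hDdef
  have hD : 0 < D := mul_pos (inv_pos.2 hpv) hc
  have hrC : ∀ t ∈ Ioo t₀ t₁, ContDiffAt ℝ 2 r t := fun t h =>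
    contDiffAt_const.mul ((hs t h).wedge_left p)
  have hyC : ∀ t ∈ Ioo t₀ t₁, ContDiffAt ℝ 2 y t := fun t h =>
    contDiffAt_const.mul ((hu t h).wedge_left v)
  have hsr : ∀ t ∈ Ioo t₀ t₁, s t = (1 : ℝ) • p + r t • v := by
    intro t h
    obtain ⟨ρ, hρ⟩ := hline t h
    have : r t = ρ := by
      simp only [hr]
      rw [hρ, wedge_add_right, wedge_self, wedge_smul_right, ← hq]
      field_simp
      ring
    rw [this, one_smul, hρ]
  have hur : ∀ t ∈ Ioo t₀ t₁, u t = (-1 * y t) • p + (D + r t * (-1 * y t)) • v := by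
    intro t h
    have h1 := hwedge t h
    rw [hsr t h, wedge_add_left, wedge_smul_left, wedge_smul_left] at h1
    have h2 : q * y t = wedge v (u t) := by simp only [hy]; field_simp
    have h3 : q * D = c := by simp only [hDdef]; field_simp
    have h4 : q • u t = q • ((-1 * y t) • p + (D + r t * (-1 * y t)) • v) := by
      rw [hq, wedge_smul_eq p v (u t), ← hq, wedge_swap (u t) v, ← h2]
      rw [show wedge p (u t) = q * D - r t * (q * y t) by rw [h3, h2]; linarith]
      module
    exact smul_right_injective _ hpv.ne' h4
  have hwr : ∀ t ∈ Ioo t₀ t₁, w t =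
      (-1 * (1 - y t)) • p + (-D + r t * (-1 * (1 - y t))) • v := by
    intro t h
    rw [eq_neg_of_add_eq_zero_right (hsum t h), hsr t h, hur t h]
    module
  have hyd : ∀ t ∈ Ioo t₀ t₁, deriv (fun s => -1 * y s) t = -deriv y t ∧
      deriv (deriv fun s => -1 * y s) t = -deriv (deriv y) t := by
    intro t _
    simp
  have hzd : ∀ t ∈ Ioo t₀ t₁, deriv (fun s => -1 * (1 - y s)) t = deriv y t ∧
      deriv (deriv fun s => -1 * (1 - y s)) t = deriv (deriv y) t := by
    intro t _
    simp
  have hyC' : ∀ t ∈ Ioo t₀ t₁, ContDiffAt ℝ 2 (fun s => -1 * y s) t := fun t h =>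
    contDiffAt_const.mul (hyC t h)
  have hzC : ∀ t ∈ Ioo t₀ t₁, ContDiffAt ℝ 2 (fun s => -1 * (1 - y s)) t := fun t h =>
    contDiffAt_const.mul (contDiffAt_const.sub (hyC t h))
  refine improvable_of_preimage (basisEquiv p v hpv.ne')
    (improvable_of_normalized_arcs (isCSCD_preimage hK _) hD ht hrC hyC ?_ ?_ ?_ ?_ ?_ ?_)
  · intro t h
    rw [mem_frontier_preimage, basisEquiv_apply]
    simpa only [hsr t h] using hsF t h
  · intro t h
    rw [mem_frontier_preimage, basisEquiv_apply]
    have := huF t h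
    rw [hur t h] at this
    convert this using 1
    simp only [rayPoint]
    module
  · intro t h
    rw [mem_frontier_preimage, basisEquiv_apply]
    have := hK.neg_frontier (hwF t h)
    rw [hwr t h] at this
    convert this using 1
    simp only [rayPoint]
    module
  · intro t h h0
    refine hs' t h ?_
    have h1 : s =ᶠ[𝓝 t] fun x => (1 : ℝ) • p + r x • v := by
      filter_upwards [hnhds t h] with x hx using hsr x hx
    rw [h1.deriv_eq, (hasDerivAt_coords (hasDerivAt_const t (1 : ℝ))
      ((hrC t h).differentiableAt (by simp)).hasDerivAt).deriv, h0]
    simp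
  · intro t h h0
    refine hCu t h ?_
    have h1 : u =ᶠ[𝓝 t] fun x => (-1 * y x) • p + (D + r x * (-1 * y x)) • v := by
      filter_upwards [hnhds t h] with x hx using hur x hx
    have h2 := deriv_two_const_add_mul D (hrC t h) (hyC' t h)
    rw [wedge_deriv_coords (hyC' t h) (contDiffAt_const.add ((hrC t h).mul (hyC' t h))) h1,
      h2.1, h2.2, (hyd t h).1, (hyd t h).2]
    linear_combination wedge p v * h0
  · intro t h h0
    refine hCw t h ?_
    have h1 : w =ᶠ[𝓝 t]
        fun x => (-1 * (1 - y x)) • p + (-D + r x * (-1 * (1 - y x))) • v := by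
      filter_upwards [hnhds t h] with x hx using hwr x hx
    have h2 := deriv_two_const_add_mul (-D) (hrC t h) (hzC t h)
    rw [wedge_deriv_coords (hzC t h) (contDiffAt_const.add ((hrC t h).mul (hzC t h))) h1,
      h2.1, h2.2, (hzd t h).1, (hzd t h).2]
    linear_combination wedge p v * h0

lemma improvable_of_edge {K : Set (ℝ × ℝ)} (hK : IsCSCD K) {t₀ t₁ c : ℝ} (hc : 0 < c)
    (ht : t₀ < t₁) {s u w : ℝ → ℝ × ℝ} {p v : ℝ × ℝ} (hpv : wedge p v ≠ 0)
    (hs : ∀ t ∈ Ioo t₀ t₁, ContDiffAt ℝ 2 s t) (hu : ∀ t ∈ Ioo t₀ t₁, ContDiffAt ℝ 2 u t)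
    (hline : ∀ t ∈ Ioo t₀ t₁, ∃ r : ℝ, s t = p + r • v)
    (hsum : ∀ t ∈ Ioo t₀ t₁, s t + u t + w t = 0)
    (hwedge : ∀ t ∈ Ioo t₀ t₁, wedge (s t) (u t) = c)
    (hsF : ∀ t ∈ Ioo t₀ t₁, s t ∈ frontier K) (huF : ∀ t ∈ Ioo t₀ t₁, u t ∈ frontier K)
    (hwF : ∀ t ∈ Ioo t₀ t₁, w t ∈ frontier K) (hs' : ∀ t ∈ Ioo t₀ t₁, deriv s t ≠ 0)
    (hCu : ∀ t ∈ Ioo t₀ t₁, wedge (deriv u t) (deriv (deriv u) t) ≠ 0)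
    (hCw : ∀ t ∈ Ioo t₀ t₁, wedge (deriv w t) (deriv (deriv w) t) ≠ 0) : Improvable K := by
  rcases lt_or_gt_of_ne hpv with h | h
  · refine improvable_of_edge_of_pos hK hc ht (p := p) (v := -v) (by rw [wedge_neg_right]; linarith)
      hs hu (fun t htI => ?_) hsum hwedge hsF huF hwF hs' hCu hCw
    obtain ⟨r, hr⟩ := hline t htI
    exact ⟨-r, by rw [hr, neg_smul_neg]⟩
  · exact improvable_of_edge_of_pos hK hc ht h hs hu hline hsum hwedge hsF huF hwF hs' hCu hCw

/-- A line through the origin meets the boundary in a pair of opposite points. -/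
lemma abs_eq_of_smul_mem_frontier {K : Set (ℝ × ℝ)} (hK : IsCSCD K) {v : ℝ × ℝ} {a b : ℝ}
    (ha : a • v ∈ frontier K) (hb : b • v ∈ frontier K) : |a| = |b| := by
  have key : ∀ a b : ℝ, a • v ∈ frontier K → b • v ∈ frontier K → |b| ≤ |a| := by
    intro a b ha hb
    by_contra! hlt
    have hpos : 0 < |b| := (abs_nonneg a).trans_lt hlt
    have hb' : |b| • v ∈ K := by
      rcases abs_choice b with h | h <;> rw [h]
      · exact (hK.frontier_iff.1 hb).1
      · rw [neg_smul]
        exact hK.neg_mem (hK.frontier_iff.1 hb).1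
    have h_in : (1 - |a| / |b|) • (0 : ℝ × ℝ) + (|a| / |b|) • |b| • v ∈ interior K :=
      hK.1.combo_interior_self_mem_interior hK.zero_mem_interior hb'
        (sub_pos.2 ((div_lt_one hpos).2 hlt)) (by positivity) (by ring)
    rw [smul_zero, zero_add, smul_smul, div_mul_cancel₀ _ hpos.ne'] at h_in
    rcases abs_choice a with h | h <;> rw [h] at h_in
    · exact (hK.frontier_iff.1 ha).2 h_in
    · rw [neg_smul] at h_in
      exact (hK.frontier_iff.1 (hK.neg_frontier ha)).2 h_in
  exact le_antisymm (key b a hb ha) (key a b ha hb)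

/-- An injective curve on an edge of the boundary does not run along a line through the origin. -/
lemma wedge_ne_zero_of_injOn {K : Set (ℝ × ℝ)} (hK : IsCSCD K) {t₀ t₁ : ℝ} (ht : t₀ < t₁)
    {s : ℝ → ℝ × ℝ} {p v : ℝ × ℝ} (hv : v ≠ 0) (hinj : InjOn s (Icc t₀ t₁))
    (hsF : ∀ t ∈ Icc t₀ t₁, s t ∈ frontier K)
    (hline : ∀ t ∈ Icc t₀ t₁, ∃ r : ℝ, s t = p + r • v) : wedge p v ≠ 0 := by
  intro h0
  obtain ⟨k, hk⟩ : ∃ k : ℝ, p = k • v := by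
    have h1 : p.1 * v.2 = p.2 * v.1 := by simp only [wedge] at h0; linarith
    by_cases hv1 : v.1 = 0
    · have hv2 : v.2 ≠ 0 := fun h => hv (Prod.ext hv1 h)
      rw [hv1, mul_zero] at h1
      refine ⟨p.2 / v.2, Prod.ext ?_ ?_⟩
      · simpa [hv1, hv2] using h1
      · simp [hv2]
    · refine ⟨p.1 / v.1, Prod.ext ?_ ?_⟩
      · simp [hv1]
      · simp only [Prod.smul_snd, smul_eq_mul]
        field_simp
        linarith
  have hρ : ∀ t ∈ Icc t₀ t₁, ∃ a : ℝ, s t = a • v := by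
    intro t h
    obtain ⟨r, hr⟩ := hline t h
    exact ⟨k + r, by rw [hr, hk, add_smul]⟩
  have hm : (t₀ + t₁) / 2 ∈ Icc t₀ t₁ := ⟨by linarith, by linarith⟩
  have hl : t₀ ∈ Icc t₀ t₁ := left_mem_Icc.2 ht.le
  have hrI : t₁ ∈ Icc t₀ t₁ := right_mem_Icc.2 ht.le
  obtain ⟨a, ha⟩ := hρ _ hl
  obtain ⟨b, hb⟩ := hρ _ hm
  obtain ⟨c, hc⟩ := hρ _ hrI
  have hab : |a| = |b| := abs_eq_of_smul_mem_frontier hK (ha ▸ hsF _ hl) (hb ▸ hsF _ hm)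
  have hbc : |b| = |c| := abs_eq_of_smul_mem_frontier hK (hb ▸ hsF _ hm) (hc ▸ hsF _ hrI)
  have hab' : a ≠ b := by
    rintro rfl
    have := hinj hl hm (ha.trans hb.symm)
    linarith
  have hbc' : b ≠ c := by
    rintro rfl
    have := hinj hm hrI (hb.trans hc.symm)
    linarith
  have hac' : a ≠ c := by
    rintro rfl
    have := hinj hl hrI (ha.trans hc.symm)
    linarith
  rcases abs_eq_abs.1 hab with h | h
  · exact hab' h
  · rcases abs_eq_abs.1 hbc with h' | h'
    · exact hbc' h'
    · exact hac' (by rw [h, h', neg_neg])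

/-- No segment of the boundary of a miserly domain is parametrized by a
multi-curve of rank two: exactly one of the components `σ 0, σ 2, σ 4` travels
along an affine line and the other two have nonvanishing curvature. -/
theorem no_rank_two_on_miserly_boundary (K : Set (ℝ × ℝ)) (hK : IsMiserly K)
    (t₀ t₁ : ℝ) (ht : t₀ < t₁) (σ : ZMod 6 → ℝ → ℝ × ℝ) :
    ¬ (IsMultiCurve σ t₀ t₁ ∧
       (∀ j, ContDiffOn ℝ 2 (σ j) (Set.Icc t₀ t₁)) ∧
       (∀ j, Set.InjOn (σ j) (Set.Icc t₀ t₁)) ∧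
       (∀ j, ∀ t ∈ Set.Icc t₀ t₁, derivWithin (σ j) (Set.Icc t₀ t₁) t ≠ 0) ∧
       (∀ j, ∀ t ∈ Set.Icc t₀ t₁, σ j t ∈ frontier K) ∧
       (∃ j₀ ∈ ({0, 2, 4} : Set (ZMod 6)),
         (∃ p v : ℝ × ℝ, v ≠ 0 ∧ ∀ t ∈ Set.Icc t₀ t₁, ∃ r : ℝ, σ j₀ t = p + r • v) ∧
         (∀ j ∈ ({0, 2, 4} : Set (ZMod 6)), j ≠ j₀ →
           ∀ t ∈ Set.Ioo t₀ t₁,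
             wedge (deriv (σ j) t) (deriv (deriv (σ j)) t) ≠ 0))) := by
  rintro ⟨hmc, hC2, hinj, hreg, hF, j₀, hj₀, ⟨p, v, hv, hline⟩, hcurv⟩
  have hIoo : ∀ t ∈ Ioo t₀ t₁, t ∈ Icc t₀ t₁ := fun t h => Ioo_subset_Icc_self h
  have hIcc : ∀ t ∈ Ioo t₀ t₁, Icc t₀ t₁ ∈ 𝓝 t := fun t h => Icc_mem_nhds h.1 h.2
  have hC : ∀ j, ∀ t ∈ Ioo t₀ t₁, ContDiffAt ℝ 2 (σ j) t := fun j t h =>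
    (hC2 j).contDiffAt (hIcc t h)
  have hidx : ∀ j ∈ ({0, 2, 4} : Set (ZMod 6)), (j + 2 ∈ ({0, 2, 4} : Set (ZMod 6)) ∧ j + 2 ≠ j) ∧
      (j + 4 ∈ ({0, 2, 4} : Set (ZMod 6)) ∧ j + 4 ≠ j) := by
    rintro j (rfl | rfl | rfl) <;> simp only [mem_insert_iff, mem_singleton_iff] <;> decide
  obtain ⟨⟨h2, h2'⟩, h4, h4'⟩ := hidx j₀ hj₀
  refine not_improvable_of_isMiserly hK (improvable_of_edge hK.1
    (c := Real.sqrt 3 / 2) (by positivity) ht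
    (wedge_ne_zero_of_injOn hK.1 ht hv (hinj j₀) (hF j₀) hline) (hC j₀) (hC (j₀ + 2))
    (fun t h => hline t (hIoo t h)) (w := σ (j₀ + 4)) (fun t h => (hmc.2 t (hIoo t h) j₀).1)
    (fun t h => (hmc.2 t (hIoo t h) j₀).2.2) (fun t h => hF _ t (hIoo t h))
    (fun t h => hF _ t (hIoo t h)) (fun t h => hF _ t (hIoo t h)) (fun t h => ?_)
    (hcurv _ h2 h2') (hcurv _ h4 h4'))
  rw [← derivWithin_of_mem_nhds (hIcc t h)]
  exact hreg j₀ t (hIoo t h)
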